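/- Let n ≥ 1, s ∈ (0,1), β > 0 and let Ω ⊆ ℝⁿ be an open set. Let K satisfy the symmetry, growth and Hölder conditions (i)–(iii). Let f ∈ L²(Ω) and let u ∈ X(Ω) with ‖u‖_{L¹_β(ℝⁿ)} < ∞ be a solution of E_K(u,·) = f in Ω. Then for every open set Ω′ whose closure is compact and contained in Ω, there exists a constant C > 0, depending only on n, s, β, λ, Λ, M, Γ, Ω and Ω′ (and not on u or f), such that ‖u‖_{L²(Ω′)} + sup_{z ∈ ℝⁿ \ {0}} |z|^{−2s} ‖Δ_z² u‖_{L²(Ω′_{2z})} ≤ C ( ‖u‖_{L²(Ω)} + ‖u‖_{L¹_β(ℝⁿ)} + ‖f‖_{L²(Ω)} ). In particular the left-hand side is finite, i.e. u ∈ N^{2s,2}(Ω′). -/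

import Mathlib

open MeasureTheory Set Metric

noncomputable section

abbrev V (n : ℕ) : Type := EuclideanSpace ℝ (Fin n)

variable {n : ℕ}

/-- The cross-shaped set `C_Ω = (ℝⁿ×ℝⁿ) \ ((ℝⁿ\Ω)×(ℝⁿ\Ω))`. -/
def crossSet (Ω : Set (V n)) : Set (V n × V n) := {p | p.1 ∈ Ω ∨ p.2 ∈ Ω}

/-- Membership in the energy space `X(Ω)`. -/
def MemX (Ω : Set (V n)) (K : V n → V n → ℝ) (u : V n → ℝ) : Prop :=
  Measurable u ∧ IntegrableOn (fun x => u x ^ 2) Ω ∧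
    IntegrableOn (fun p : V n × V n => (u p.1 - u p.2) ^ 2 * K p.1 p.2) (crossSet Ω)

/-- Membership in `X₀(Ω)`: member of `X(Ω)` vanishing a.e. outside `Ω`. -/
def MemX0 (Ω : Set (V n)) (K : V n → V n → ℝ) (u : V n → ℝ) : Prop :=
  MemX Ω K u ∧ ∀ᵐ x ∂(volume : Measure (V n)), x ∉ Ω → u x = 0

/-- The bilinear form `E_K(u,φ)`. -/
def energyForm (K : V n → V n → ℝ) (u φ : V n → ℝ) : ℝ :=
  ∫ x, ∫ y, (u x - u y) * (φ x - φ y) * K x y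

/-- `u` is a weak solution of `E_K(u,·) = f` in `Ω`. -/
def IsSolution (Ω : Set (V n)) (K : V n → V n → ℝ) (u f : V n → ℝ) : Prop :=
  ∀ φ : V n → ℝ, MemX0 Ω K φ → energyForm K u φ = ∫ x in Ω, f x * φ x

/-- Symmetry of the kernel. -/
def KSym (K : V n → V n → ℝ) : Prop :=
  ∀ᵐ p ∂(volume : Measure (V n × V n)), K p.1 p.2 = K p.2 p.1

/-- Growth conditions (i) and (ii) on the kernel. -/
def KBounds (s β lam Lam M : ℝ) (K : V n → V n → ℝ) : Prop :=
  (∀ᵐ p ∂(volume : Measure (V n × V n)), ‖p.1 - p.2‖ < 1 →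
      lam ≤ ‖p.1 - p.2‖ ^ ((n : ℝ) + 2 * s) * K p.1 p.2 ∧
        ‖p.1 - p.2‖ ^ ((n : ℝ) + 2 * s) * K p.1 p.2 ≤ Lam) ∧
  ∀ᵐ p ∂(volume : Measure (V n × V n)), 1 ≤ ‖p.1 - p.2‖ →
      0 ≤ ‖p.1 - p.2‖ ^ ((n : ℝ) + β) * K p.1 p.2 ∧
        ‖p.1 - p.2‖ ^ ((n : ℝ) + β) * K p.1 p.2 ≤ M

/-- Hölder condition (iii) on the kernel (local translation regularity). -/
def KHolder (s Gam : ℝ) (K : V n → V n → ℝ) : Prop :=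
  ∀ᵐ q ∂(volume : Measure (V n × V n × V n)),
    ‖q.2.1 - q.2.2‖ < 1 → ‖q.1‖ < 1 →
      ‖q.2.1 - q.2.2‖ ^ ((n : ℝ) + 2 * s) *
          |K (q.2.1 + q.1) (q.2.2 + q.1) - K q.2.1 q.2.2| ≤ Gam * ‖q.1‖ ^ s

/-- The `L²` norm over a set `A`. -/
def L2norm (A : Set (V n)) (u : V n → ℝ) : ℝ := (∫ x in A, u x ^ 2) ^ ((1 : ℝ) / 2)

/-- The weighted norm `‖u‖_{L¹_{x₀,β}(ℝⁿ)}`. -/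
def wnorm (β : ℝ) (x₀ : V n) (u : V n → ℝ) : ℝ :=
  ∫ x, |u x| / (1 + ‖x - x₀‖ ^ ((n : ℝ) + β))

/-- Finiteness of the weighted norm `‖u‖_{L¹_{x₀,β}(ℝⁿ)}`. -/
def HasFiniteWnorm (β : ℝ) (x₀ : V n) (u : V n → ℝ) : Prop :=
  Integrable (fun x => |u x| / (1 + ‖x - x₀‖ ^ ((n : ℝ) + β)))

/-- The second difference `Δ_z² u(x) = u(x+2z) − 2u(x+z) + u(x)`. -/
def diff2 (z : V n) (u : V n → ℝ) (x : V n) : ℝ := u (x + 2 • z) - 2 * u (x + z) + u x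

/-- The set `U_{2z} = {x ∈ U : x+z ∈ U, x+2z ∈ U}`. -/
def shift2 (U : Set (V n)) (z : V n) : Set (V n) := {x ∈ U | x + z ∈ U ∧ x + 2 • z ∈ U}

theorem abs_integral_mul_le_sqrt {α : Type*} [MeasurableSpace α] {μ : Measure α} {f g : α → ℝ}
    (hf : AEStronglyMeasurable f μ) (hg : AEStronglyMeasurable g μ)
    (hf2 : Integrable (fun x => f x ^ 2) μ) (hg2 : Integrable (fun x => g x ^ 2) μ) :
    Integrable (fun x => f x * g x) μ ∧
      ∫ x, |f x * g x| ∂μ ≤ √(∫ x, f x ^ 2 ∂μ) * √(∫ x, g x ^ 2 ∂μ) := by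
  have mf : MemLp f 2 μ := (memLp_two_iff_integrable_sq hf).2 hf2
  have mg : MemLp g 2 μ := (memLp_two_iff_integrable_sq hg).2 hg2
  refine ⟨mf.integrable_mul mg, ?_⟩
  have h2 : ENNReal.ofReal 2 = 2 := by simp
  have := integral_mul_le_Lp_mul_Lq_of_nonneg (μ := μ) (p := 2) (q := 2)
    (Real.HolderConjugate.two_two) (f := fun x => |f x|) (g := fun x => |g x|)
    (Filter.Eventually.of_forall fun x => abs_nonneg _)
    (Filter.Eventually.of_forall fun x => abs_nonneg _)
    (by rw [h2]; exact mf.norm) (by rw [h2]; exact mg.norm)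
  simpa [abs_mul, Real.sqrt_eq_rpow] using this

theorem integrable_snd_mul_sub {f q : V n → ℝ} (hf : Integrable f) (hq : Integrable q) :
    Integrable (fun p : V n × V n => f p.2 * q (p.1 - p.2)) ∧
      ∫ p : V n × V n, f p.2 * q (p.1 - p.2) = (∫ x, f x) * ∫ x, q x := by
  have mp := measurePreserving_sub_prod (volume : Measure (V n)) (volume : Measure (V n))
  have hi : Integrable (fun p : V n × V n => q p.1 * f p.2)
    ((volume : Measure (V n)).prod (volume : Measure (V n))) := hq.mul_prod hf
  have e : (fun p : V n × V n => f p.2 * q (p.1 - p.2)) =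
      (fun p : V n × V n => q p.1 * f p.2) ∘ fun p => (p.1 - p.2, p.2) := by
    ext p; simp [mul_comm]
  rw [e]
  refine ⟨mp.integrable_comp_of_integrable hi, ?_⟩
  have h1 := integral_map (μ := (volume : Measure (V n)).prod (volume : Measure (V n)))
    mp.measurable.aemeasurable (f := fun p : V n × V n => q p.1 * f p.2)
    (by rw [mp.map_eq]; exact hi.1)
  rw [mp.map_eq, integral_prod_mul] at h1
  rw [mul_comm, h1]
  rfl

theorem integrable_fst_mul_sub {f q : V n → ℝ} (hf : Integrable f) (hq : Integrable q)
    (hev : ∀ x, q (-x) = q x) :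
    Integrable (fun p : V n × V n => f p.1 * q (p.1 - p.2)) ∧
      ∫ p : V n × V n, f p.1 * q (p.1 - p.2) = (∫ x, f x) * ∫ x, q x := by
  obtain ⟨h1, h2⟩ := integrable_snd_mul_sub hf hq
  have e : (fun p : V n × V n => f p.1 * q (p.1 - p.2)) =
      (fun p : V n × V n => f p.2 * q (p.1 - p.2)) ∘ Prod.swap := by
    ext p; simp only [Function.comp, Prod.fst_swap, Prod.snd_swap]
    rw [← hev (p.2 - p.1), neg_sub]
  rw [e]
  refine ⟨h1.swap, ?_⟩
  rw [← h2]
  exact integral_prod_swap (μ := (volume : Measure (V n))) (ν := (volume : Measure (V n)))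
    (fun p : V n × V n => f p.2 * q (p.1 - p.2))

/-- The truncated fractional kernel `1_{|x| < d} |x|^{-a}`. -/
def riesz (d a : ℝ) (x : V n) : ℝ := if ‖x‖ < d then ‖x‖ ^ (-a) else 0

theorem riesz_nonneg (d a : ℝ) (x : V n) : 0 ≤ riesz d a x := by
  unfold riesz; split_ifs <;> positivity

theorem riesz_neg (d a : ℝ) (x : V n) : riesz d a (-x) = riesz d a x := by
  simp [riesz]

theorem measurable_riesz (d a : ℝ) : Measurable (riesz d a : V n → ℝ) := by
  unfold riesz
  exact Measurable.ite (measurableSet_lt (by fun_prop) (by fun_prop)) (by fun_prop) (by fun_prop)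

theorem integrable_sq_mul_riesz (hn : 1 ≤ n) (d : ℝ) {s : ℝ} (hs : s < 1) :
    Integrable (fun x : V n => ‖x‖ ^ 2 * riesz d ((n : ℝ) + 2 * s) x) := by
  have : Nonempty (Fin n) := ⟨⟨0, hn⟩⟩
  have h : IntegrableOn (fun x : V n => ‖x‖ ^ 2 * ‖x‖ ^ (-((n : ℝ) + 2 * s))) (ball 0 d) := by
    rw [integrableOn_fun_norm_addHaar (μ := volume) (E := V n)
      (f := fun r : ℝ => r ^ 2 * r ^ (-((n : ℝ) + 2 * s)))]
    rcases le_or_gt d 0 with hd | hd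
    · simp [Ioo_eq_empty (not_lt.2 hd)]
    refine ((intervalIntegral.integrableOn_Ioo_rpow_iff (s := 1 - 2 * s) hd).2
      (by linarith)).congr_fun ?_ measurableSet_Ioo
    intro r hr
    have hr0 : 0 < r := hr.1
    simp only [finrank_euclideanSpace, Fintype.card_fin, smul_eq_mul]
    rw [← Real.rpow_natCast, ← Real.rpow_natCast, ← Real.rpow_add hr0, ← Real.rpow_add hr0]
    congr 1
    push_cast [Nat.cast_sub hn]
    ring
  rw [← integrable_indicator_iff measurableSet_ball] at h
  refine h.congr (Filter.Eventually.of_forall fun x => ?_)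
  by_cases hx : ‖x‖ < d <;> simp [indicator, riesz, hx]

/-- The decaying weight `1 / (1 + |x|^a)`. -/
def weight (a : ℝ) (x : V n) : ℝ := 1 / (1 + ‖x‖ ^ a)

theorem weight_pos (a : ℝ) (x : V n) : 0 < weight a x := by unfold weight; positivity

theorem weight_neg (a : ℝ) (x : V n) : weight a (-x) = weight a x := by simp [weight]

theorem measurable_weight (a : ℝ) : Measurable (weight a : V n → ℝ) := by
  unfold weight; fun_prop

theorem add_rpow_le_two_rpow_mul {a b r : ℝ} (ha : 0 ≤ a) (hb : 0 ≤ b) (hr : 0 ≤ r) :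
    (a + b) ^ r ≤ 2 ^ r * (a ^ r + b ^ r) := by
  rcases le_total a b with h | h
  · calc (a + b) ^ r ≤ (2 * b) ^ r := Real.rpow_le_rpow (by positivity) (by linarith) hr
      _ = 2 ^ r * b ^ r := Real.mul_rpow (by norm_num) hb
      _ ≤ _ := by gcongr; linarith [Real.rpow_nonneg ha r]
  · calc (a + b) ^ r ≤ (2 * a) ^ r := Real.rpow_le_rpow (by positivity) (by linarith) hr
      _ = 2 ^ r * a ^ r := Real.mul_rpow (by norm_num) ha
      _ ≤ _ := by gcongr; linarith [Real.rpow_nonneg hb r]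

theorem integrable_weight {β : ℝ} (hβ : 0 < β) :
    Integrable (weight ((n : ℝ) + β) : V n → ℝ) := by
  have h := integrable_one_add_norm (E := V n) (μ := volume) (r := (n : ℝ) + β)
    (by simp [hβ])
  refine (h.const_mul (2 ^ ((n : ℝ) + β))).mono' (measurable_weight _).aestronglyMeasurable
    (Filter.Eventually.of_forall fun x => ?_)
  rw [Real.norm_of_nonneg (weight_pos _ _).le, weight, Real.rpow_neg (by positivity),
    ← div_eq_mul_inv, div_le_div_iff₀ (by positivity) (by positivity), one_mul]
  simpa using add_rpow_le_two_rpow_mul (a := 1) (b := ‖x‖) (r := (n : ℝ) + β) (by norm_num)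
    (norm_nonneg _) (by positivity)

theorem weight_sub_le {a R : ℝ} (ha : 0 ≤ a) {x : V n} (hx : ‖x‖ ≤ R) (y : V n) :
    weight a (x - y) ≤ (1 + 2 ^ a + 2 ^ a * R ^ a) * weight a y := by
  have hR : 0 ≤ R := (norm_nonneg _).trans hx
  have h1 : ‖y‖ ≤ ‖x - y‖ + R := by
    have := norm_sub_norm_le y x
    rw [norm_sub_rev] at this; linarith
  have h2 : ‖y‖ ^ a ≤ 2 ^ a * (‖x - y‖ ^ a + R ^ a) :=
    (Real.rpow_le_rpow (norm_nonneg _) h1 ha).trans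
      (add_rpow_le_two_rpow_mul (norm_nonneg _) hR ha)
  have h3 : 0 ≤ ‖x - y‖ ^ a := by positivity
  have h4 : (0 : ℝ) ≤ 2 ^ a := by positivity
  have h5 : (0 : ℝ) ≤ R ^ a := by positivity
  rw [weight, weight, mul_one_div, div_le_div_iff₀ (by positivity) (by positivity), one_mul]
  nlinarith [mul_nonneg h4 h5, mul_nonneg (mul_nonneg h4 h5) h3]

/-- The increment `w(x) - w(y)` as a function on the product space. -/
def incr (w : V n → ℝ) (p : V n × V n) : ℝ := w p.1 - w p.2

/-- The truncated Gagliardo energy of order `(a - n) / 2`. -/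
def nearEnergy (d a : ℝ) (w : V n → ℝ) : ℝ :=
  ∫ p : V n × V n, incr w p ^ 2 * riesz d a (p.1 - p.2)

/-- Square integrable functions with finite truncated Gagliardo energy. -/
structure FiniteEnergy (d a : ℝ) (w : V n → ℝ) : Prop where
  measurable : Measurable w
  sq : Integrable fun x => w x ^ 2
  energy : Integrable fun p : V n × V n => incr w p ^ 2 * riesz d a (p.1 - p.2)

/-- The squared `L²` norm on the whole space. -/
def sqNorm (w : V n → ℝ) : ℝ := ∫ x, w x ^ 2

/-- The bilinear form with kernel `κ`, as an integral over the product space. -/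
def kerForm (κ : V n × V n → ℝ) (u φ : V n → ℝ) : ℝ :=
  ∫ p : V n × V n, incr u p * incr φ p * κ p

theorem nearEnergy_nonneg (d a : ℝ) (w : V n → ℝ) : 0 ≤ nearEnergy d a w :=
  integral_nonneg fun _ => mul_nonneg (sq_nonneg _) (riesz_nonneg _ _ _)

@[fun_prop]
theorem measurable_incr {w : V n → ℝ} (hw : Measurable w) : Measurable (incr w) := by
  unfold incr; fun_prop

theorem measurable_riesz_sub (d a : ℝ) :
    Measurable fun p : V n × V n => riesz d a (p.1 - p.2) :=
  (measurable_riesz d a).comp (by fun_prop)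

theorem FiniteEnergy.sub {d a : ℝ} {u w : V n → ℝ} (hu : FiniteEnergy d a u)
    (hw : FiniteEnergy d a w) : FiniteEnergy d a fun x => u x - w x := by
  have hm : Measurable fun x => u x - w x := hu.measurable.sub hw.measurable
  refine ⟨hm, ?_, ?_⟩
  · refine ((hu.sq.const_mul 2).add (hw.sq.const_mul 2)).mono'
      (hm.pow_const 2).aestronglyMeasurable (Filter.Eventually.of_forall fun x => ?_)
    rw [Real.norm_of_nonneg (sq_nonneg _)]
    simp only [Pi.add_apply]
    nlinarith [sq_nonneg (u x + w x)]
  · refine ((hu.energy.const_mul 2).add (hw.energy.const_mul 2)).mono'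
      (((measurable_incr hm).pow_const 2).mul (measurable_riesz_sub d a)).aestronglyMeasurable
      (Filter.Eventually.of_forall fun p => ?_)
    rw [Real.norm_of_nonneg (mul_nonneg (sq_nonneg _) (riesz_nonneg _ _ _))]
    simp only [Pi.add_apply, incr]
    nlinarith [riesz_nonneg d a (p.1 - p.2),
      mul_nonneg (sq_nonneg (u p.1 - u p.2 + (w p.1 - w p.2))) (riesz_nonneg d a (p.1 - p.2))]

theorem measurePreserving_add_diag (z : V n) :
    MeasurePreserving (fun p : V n × V n => (p.1 + z, p.2 + z)) :=
  (measurePreserving_add_right volume z).prod (measurePreserving_add_right volume z)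

theorem integrable_comp_add_diag {F : V n × V n → ℝ} (hF : Integrable F) (z : V n) :
    Integrable fun p : V n × V n => F (p.1 + z, p.2 + z) :=
  (measurePreserving_add_diag z).integrable_comp_of_integrable hF

theorem integral_comp_add_diag (F : V n × V n → ℝ) (z : V n) :
    ∫ p : V n × V n, F (p.1 + z, p.2 + z) = ∫ p, F p :=
  integral_add_right_eq_self (μ := (volume : Measure (V n)).prod volume) F (z, z)

theorem FiniteEnergy.shift {d a : ℝ} {w : V n → ℝ} (hw : FiniteEnergy d a w) (z : V n) :
    FiniteEnergy d a fun x => w (x + z) := by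
  refine ⟨hw.measurable.comp (by fun_prop), hw.sq.comp_add_right z, ?_⟩
  convert! integrable_comp_add_diag hw.energy z using 2 with p
  simp [incr]

theorem sqNorm_shift (w : V n → ℝ) (z : V n) : sqNorm (fun x => w (x + z)) = sqNorm w :=
  integral_add_right_eq_self (μ := volume) (fun x => w x ^ 2) z

theorem nearEnergy_shift (d a : ℝ) (w : V n → ℝ) (z : V n) :
    nearEnergy d a (fun x => w (x + z)) = nearEnergy d a w := by
  unfold nearEnergy
  rw [← integral_comp_add_diag (fun p => incr w p ^ 2 * riesz d a (p.1 - p.2)) z]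
  simp [incr]

/-- Lipschitz functions with values in `[0,1]`. -/
structure IsCutoff (L : ℝ) (η : V n → ℝ) : Prop where
  nonneg : ∀ x, 0 ≤ η x
  le_one : ∀ x, η x ≤ 1
  lip : ∀ x y, |η x - η y| ≤ L * ‖x - y‖
  measurable : Measurable η

theorem IsCutoff.sq_sub_le {L : ℝ} {η : V n → ℝ} (hη : IsCutoff L η) (x y : V n) :
    (η x - η y) ^ 2 ≤ L ^ 2 * ‖x - y‖ ^ 2 := by
  rw [← mul_pow, ← sq_abs]
  exact pow_le_pow_left₀ (abs_nonneg _) (hη.lip x y) 2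

theorem IsCutoff.sq_le_one {L : ℝ} {η : V n → ℝ} (hη : IsCutoff L η) (x : V n) :
    η x ^ 2 ≤ 1 := pow_le_one₀ (hη.nonneg x) (hη.le_one x)

theorem IsCutoff.sq_mul_le {L : ℝ} {η : V n → ℝ} (hη : IsCutoff L η) (w : V n → ℝ) (x : V n) :
    (η x * w x) ^ 2 ≤ w x ^ 2 := by
  rw [mul_pow]
  exact mul_le_of_le_one_left (sq_nonneg _) (hη.sq_le_one x)

theorem IsCutoff.integrable_sq {L : ℝ} {η w : V n → ℝ} (hη : IsCutoff L η) (hm : Measurable w)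
    (hw : Integrable fun x => w x ^ 2) : Integrable fun x => (η x * w x) ^ 2 := by
  refine hw.mono' ((hη.measurable.mul hm).pow_const 2).aestronglyMeasurable
    (Filter.Eventually.of_forall fun x => ?_)
  rw [Real.norm_of_nonneg (sq_nonneg _)]
  exact hη.sq_mul_le w x

theorem IsCutoff.sqNorm_mul_le {L : ℝ} {η w : V n → ℝ} (hη : IsCutoff L η) (hm : Measurable w)
    (hw : Integrable fun x => w x ^ 2) : sqNorm (fun x => η x * w x) ≤ sqNorm w :=
  integral_mono (hη.integrable_sq hm hw) hw fun x => hη.sq_mul_le w x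

theorem IsCutoff.incr_mul_sq_le {L : ℝ} {η : V n → ℝ} (hη : IsCutoff L η) (w : V n → ℝ)
    (p : V n × V n) :
    incr (fun x => η x * w x) p ^ 2 ≤
      2 * incr w p ^ 2 + 2 * L ^ 2 * (w p.2 ^ 2 * ‖p.1 - p.2‖ ^ 2) := by
  have h1 : incr (fun x => η x * w x) p = η p.1 * incr w p + (η p.1 - η p.2) * w p.2 := by
    simp only [incr]; ring
  have h2 := mul_le_mul_of_nonneg_right (hη.sq_sub_le p.1 p.2) (sq_nonneg (w p.2))
  have h3 := mul_le_mul_of_nonneg_right (hη.sq_le_one p.1) (sq_nonneg (incr w p))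
  rw [h1]
  nlinarith [sq_nonneg (η p.1 * incr w p - (η p.1 - η p.2) * w p.2)]

/-- The second moment of the truncated kernel. -/
def secondMoment (n : ℕ) (d a : ℝ) : ℝ := ∫ x : V n, ‖x‖ ^ 2 * riesz d a x

theorem secondMoment_nonneg (d a : ℝ) : 0 ≤ secondMoment n d a :=
  integral_nonneg fun _ => mul_nonneg (sq_nonneg _) (riesz_nonneg _ _ _)

theorem FiniteEnergy.cutoff_mul {d a L : ℝ} {η w : V n → ℝ}
    (hq : Integrable fun x : V n => ‖x‖ ^ 2 * riesz d a x) (hη : IsCutoff L η)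
    (hw : FiniteEnergy d a w) :
    FiniteEnergy d a (fun x => η x * w x) ∧
      nearEnergy d a (fun x => η x * w x) ≤
        2 * nearEnergy d a w + 2 * L ^ 2 * (sqNorm w * secondMoment n d a) := by
  have hm : Measurable fun x => η x * w x := hη.measurable.mul hw.measurable
  obtain ⟨hi, he⟩ := integrable_snd_mul_sub hw.sq hq
  have hle : ∀ p : V n × V n, incr (fun x => η x * w x) p ^ 2 * riesz d a (p.1 - p.2) ≤
      2 * (incr w p ^ 2 * riesz d a (p.1 - p.2)) +
        2 * L ^ 2 * (w p.2 ^ 2 * (‖p.1 - p.2‖ ^ 2 * riesz d a (p.1 - p.2))) := fun p => by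
    nlinarith [mul_le_mul_of_nonneg_right (hη.incr_mul_sq_le w p)
      (riesz_nonneg d a (p.1 - p.2))]
  have hint := (hw.energy.const_mul 2).add (hi.const_mul (2 * L ^ 2))
  have hE : Integrable fun p : V n × V n =>
      incr (fun x => η x * w x) p ^ 2 * riesz d a (p.1 - p.2) := by
    refine hint.mono'
      (((measurable_incr hm).pow_const 2).mul (measurable_riesz_sub d a)).aestronglyMeasurable
      (Filter.Eventually.of_forall fun p => ?_)
    rw [Real.norm_of_nonneg (mul_nonneg (sq_nonneg _) (riesz_nonneg _ _ _))]
    exact hle p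
  refine ⟨⟨hm, hη.integrable_sq hw.measurable hw.sq, hE⟩, ?_⟩
  refine (integral_mono hE hint hle).trans_eq ?_
  simp only [Pi.add_apply]
  rw [integral_add (hw.energy.const_mul 2) (hi.const_mul (2 * L ^ 2)), integral_const_mul,
    integral_const_mul, he]
  rfl

theorem integrable_kerForm {d a c : ℝ} {κ : V n × V n → ℝ} {u φ : V n → ℝ}
    (hc : 0 ≤ c) (hκm : AEStronglyMeasurable κ)
    (hκ : ∀ᵐ p, |κ p| ≤ c * riesz d a (p.1 - p.2))
    (hu : FiniteEnergy d a u) (hφ : FiniteEnergy d a φ) :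
    Integrable (fun p => incr u p * incr φ p * κ p) ∧
      |kerForm κ u φ| ≤ c * (√(nearEnergy d a u) * √(nearEnergy d a φ)) := by
  have hr : Measurable fun p : V n × V n => √(riesz d a (p.1 - p.2)) :=
    (measurable_riesz_sub d a).sqrt
  have e : ∀ (w : V n → ℝ) (p : V n × V n), (incr w p * √(riesz d a (p.1 - p.2))) ^ 2 =
      incr w p ^ 2 * riesz d a (p.1 - p.2) := fun w p => by
    rw [mul_pow, Real.sq_sqrt (riesz_nonneg _ _ _)]
  obtain ⟨h1, h2⟩ := abs_integral_mul_le_sqrt (μ := (volume : Measure (V n × V n)))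
    (f := fun p => incr u p * √(riesz d a (p.1 - p.2)))
    (g := fun p => incr φ p * √(riesz d a (p.1 - p.2)))
    ((measurable_incr hu.measurable).mul hr).aestronglyMeasurable
    ((measurable_incr hφ.measurable).mul hr).aestronglyMeasurable
    (by simpa only [e] using hu.energy) (by simpa only [e] using hφ.energy)
  simp only [e] at h2
  have hle : ∀ᵐ p : V n × V n, ‖incr u p * incr φ p * κ p‖ ≤
      c * |incr u p * √(riesz d a (p.1 - p.2)) * (incr φ p * √(riesz d a (p.1 - p.2)))| := by
    filter_upwards [hκ] with p hp
    have : incr u p * √(riesz d a (p.1 - p.2)) * (incr φ p * √(riesz d a (p.1 - p.2))) =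
        incr u p * incr φ p * riesz d a (p.1 - p.2) := by
      rw [mul_mul_mul_comm, Real.mul_self_sqrt (riesz_nonneg _ _ _)]
    rw [this, Real.norm_eq_abs, abs_mul, abs_mul _ (riesz _ _ _),
      abs_of_nonneg (riesz_nonneg d a (p.1 - p.2))]
    calc _ ≤ |incr u p * incr φ p| * (c * riesz d a (p.1 - p.2)) := by gcongr
      _ = _ := by ring
  have hI : Integrable (fun p => incr u p * incr φ p * κ p) :=
    (h1.abs.const_mul c).mono' (((measurable_incr hu.measurable).mul
      (measurable_incr hφ.measurable)).aestronglyMeasurable.mul hκm) hle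
  refine ⟨hI, (norm_integral_le_of_norm_le (h1.abs.const_mul c) hle).trans ?_⟩
  rw [integral_const_mul]
  exact mul_le_mul_of_nonneg_left h2 hc

theorem riesz_lower_bound {a δ d : ℝ} (ha : 0 ≤ a) (hδd : δ ≤ d) {x : V n} (hx0 : x ≠ 0)
    (hx : ‖x‖ < δ) : 1 ≤ δ ^ a * riesz d a x := by
  have h0 : 0 < ‖x‖ := norm_pos_iff.2 hx0
  rw [riesz, if_pos (hx.trans_le hδd), Real.rpow_neg h0.le, ← div_eq_mul_inv,
    one_le_div (by positivity)]
  exact Real.rpow_le_rpow h0.le hx.le ha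

theorem incr_sq_le_of_norm_lt {a δ d : ℝ} (ha : 0 ≤ a) (hδd : δ ≤ d) (w : V n → ℝ)
    {p : V n × V n} (hp : ‖p.1 - p.2‖ < δ) :
    incr w p ^ 2 ≤ δ ^ a * (incr w p ^ 2 * riesz d a (p.1 - p.2)) := by
  by_cases h : p.1 = p.2
  · simp [incr, h]
  · have := riesz_lower_bound ha hδd (sub_ne_zero.2 h) hp
    nlinarith [mul_le_mul_of_nonneg_left this (sq_nonneg (incr w p))]

theorem sqNorm_sub_shift_le (hn : 1 ≤ n) {s d : ℝ} (hs : 0 < s) :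
    ∃ C > 0, ∀ (w : V n → ℝ), FiniteEnergy d ((n : ℝ) + 2 * s) w → ∀ z : V n, z ≠ 0 →
      2 * ‖z‖ ≤ d → sqNorm (fun x => w (x + z) - w x) ≤
        C * ‖z‖ ^ (2 * s) * nearEnergy d ((n : ℝ) + 2 * s) w := by
  have : Nonempty (Fin n) := ⟨⟨0, hn⟩⟩
  set a : ℝ := (n : ℝ) + 2 * s with ha
  have ha0 : 0 ≤ a := by positivity
  set ω : ℝ := (volume (ball (0 : V n) 1)).toReal with hω
  have hω0 : 0 < ω := ENNReal.toReal_pos (measure_ball_pos _ _ one_pos).ne'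
    measure_ball_lt_top.ne
  refine ⟨4 * 2 ^ a / ω, by positivity, fun w hw z hz hzd => ?_⟩
  have hz0 : 0 < ‖z‖ := norm_pos_iff.2 hz
  have hv := ((hw.shift z).sub hw).sq
  have hb : Integrable (indicator (ball (0 : V n) ‖z‖) fun _ => (1 : ℝ)) :=
    (integrable_indicator_iff measurableSet_ball).2
      (integrableOn_const measure_ball_lt_top.ne)
  obtain ⟨hi, he⟩ := integrable_fst_mul_sub hv hb (fun x => by simp [indicator])
  have hsh : Integrable fun p : V n × V n =>
      incr w (p.1 + z, p.2) ^ 2 * riesz d a (p.1 + z - p.2) :=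
    ((measurePreserving_add_right volume z).prod
      (MeasurePreserving.id volume)).integrable_comp_of_integrable hw.energy
  have hshe : ∫ p : V n × V n, incr w (p.1 + z, p.2) ^ 2 * riesz d a (p.1 + z - p.2) =
      nearEnergy d a w := by
    have := integral_add_right_eq_self (μ := (volume : Measure (V n)).prod volume)
      (fun p : V n × V n => incr w p ^ 2 * riesz d a (p.1 - p.2)) (z, 0)
    simp only [Prod.add_def, add_zero] at this
    exact this
  have hle : ∀ p : V n × V n, (w (p.1 + z) - w p.1) ^ 2 *
      indicator (ball (0 : V n) ‖z‖) (fun _ => (1 : ℝ)) (p.1 - p.2) ≤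
      2 * (2 * ‖z‖) ^ a * (incr w (p.1 + z, p.2) ^ 2 * riesz d a (p.1 + z - p.2) +
        incr w p ^ 2 * riesz d a (p.1 - p.2)) := fun p => by
    have hpos : 0 ≤ 2 * (2 * ‖z‖) ^ a *
        (incr w (p.1 + z, p.2) ^ 2 * riesz d a (p.1 + z - p.2) +
        incr w p ^ 2 * riesz d a (p.1 - p.2)) := by
      have := riesz_nonneg d a (p.1 - p.2)
      have := riesz_nonneg d a (p.1 + z - p.2)
      positivity
    by_cases hp : p.1 - p.2 ∈ ball (0 : V n) ‖z‖
    · rw [indicator_of_mem hp, mul_one]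
      rw [mem_ball_zero_iff] at hp
      have h1 := incr_sq_le_of_norm_lt (p := p) ha0 hzd w (by linarith)
      have h2 := incr_sq_le_of_norm_lt (p := (p.1 + z, p.2)) ha0 hzd w (by
        have := norm_add_le (p.1 - p.2) z
        rw [sub_add_eq_add_sub] at this
        simp only; linarith)
      have h3 : w (p.1 + z) - w p.1 = incr w (p.1 + z, p.2) - incr w p := by simp [incr]
      rw [h3]
      nlinarith [sq_nonneg (incr w (p.1 + z, p.2) + incr w p)]
    · rw [indicator_of_notMem hp, mul_zero]
      exact hpos
  have hmono := integral_mono hi ((hsh.add hw.energy).const_mul (2 * (2 * ‖z‖) ^ a)) hle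
  simp only [Pi.add_apply] at hmono
  rw [he, integral_const_mul, integral_add hsh hw.energy, hshe,
    integral_indicator measurableSet_ball, setIntegral_const, smul_eq_mul, mul_one,
    measureReal_def, Measure.addHaar_ball volume (0 : V n) hz0.le, ENNReal.toReal_mul,
    ENNReal.toReal_ofReal (by positivity), finrank_euclideanSpace, Fintype.card_fin,
    ← hω, ← Real.rpow_natCast] at hmono
  change sqNorm (fun x => w (x + z) - w x) * _ ≤ _ * (nearEnergy d a w + nearEnergy d a w)
    at hmono
  rw [Real.mul_rpow (by norm_num) hz0.le,
    show ‖z‖ ^ a = ‖z‖ ^ (n : ℝ) * ‖z‖ ^ (2 * s) by rw [ha, Real.rpow_add hz0]] at hmono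
  have hzn : 0 < ‖z‖ ^ (n : ℝ) := by positivity
  have h6 : sqNorm (fun x => w (x + z) - w x) * ω ≤
      4 * 2 ^ a * ‖z‖ ^ (2 * s) * nearEnergy d a w := by
    refine le_of_mul_le_mul_left ?_ hzn
    linarith
  rw [div_mul_eq_mul_div, div_mul_eq_mul_div, le_div_iff₀ hω0]
  exact h6

theorem nearEnergy_cutoff_le_kerForm {d a L lam Lam : ℝ} {κ : V n × V n → ℝ} {η v : V n → ℝ}
    (hq : Integrable fun x : V n => ‖x‖ ^ 2 * riesz d a x) (hη : IsCutoff L η)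
    (hlam : 0 ≤ lam) (hκm : AEStronglyMeasurable κ)
    (hκ : ∀ᵐ p : V n × V n, lam * riesz d a (p.1 - p.2) ≤ κ p ∧ κ p ≤ Lam * riesz d a (p.1 - p.2))
    (hLam : 0 ≤ Lam) (hv : FiniteEnergy d a v) :
    lam * nearEnergy d a (fun x => η x * v x) ≤
      kerForm κ v (fun x => η x * (η x * v x)) +
        Lam * L ^ 2 * (sqNorm v * secondMoment n d a) := by
  have hw := (hv.cutoff_mul hq hη).1
  have hφ := (hw.cutoff_mul hq hη).1
  obtain ⟨hi, he⟩ := integrable_snd_mul_sub hv.sq hq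
  obtain ⟨hi', he'⟩ := integrable_fst_mul_sub hv.sq hq (fun x => by rw [riesz_neg, norm_neg])
  have hk := (integrable_kerForm hLam hκm (by
    filter_upwards [hκ] with p hp
    rw [abs_of_nonneg ((mul_nonneg hlam (riesz_nonneg _ _ _)).trans hp.1)]
    exact hp.2) hv hφ).1
  have hsum := (hi'.add hi).const_mul (Lam * L ^ 2 / 2)
  have hmono := integral_mono_ae (hw.energy.const_mul lam) (hk.add hsum) (by
    filter_upwards [hκ] with p hp
    have hr := riesz_nonneg d a (p.1 - p.2)
    have hκ0 : 0 ≤ κ p := (mul_nonneg hlam hr).trans hp.1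
    have h1 := mul_le_mul_of_nonneg_left hp.1 (sq_nonneg (incr (fun x => η x * v x) p))
    have h2 : incr (fun x => η x * v x) p ^ 2 = incr v p * incr (fun x => η x * (η x * v x)) p +
        v p.1 * v p.2 * (η p.1 - η p.2) ^ 2 := by
      simp only [incr]; ring
    have h3 : v p.1 * v p.2 * (η p.1 - η p.2) ^ 2 ≤
        (v p.1 ^ 2 + v p.2 ^ 2) / 2 * (L ^ 2 * ‖p.1 - p.2‖ ^ 2) :=
      mul_le_mul (by nlinarith [sq_nonneg (v p.1 - v p.2)]) (hη.sq_sub_le _ _)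
        (sq_nonneg _) (by positivity)
    have h4 := mul_le_mul_of_nonneg_right h3 hκ0
    have h5 : (v p.1 ^ 2 + v p.2 ^ 2) / 2 * (L ^ 2 * ‖p.1 - p.2‖ ^ 2) * κ p ≤
        (v p.1 ^ 2 + v p.2 ^ 2) / 2 * (L ^ 2 * ‖p.1 - p.2‖ ^ 2) *
          (Lam * riesz d a (p.1 - p.2)) :=
      mul_le_mul_of_nonneg_left hp.2 (by positivity)
    simp only [Pi.add_apply]
    nlinarith)
  simp only [Pi.add_apply] at hmono hsum
  rw [integral_const_mul, integral_add hk hsum, integral_const_mul,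
    integral_add hi' hi, he, he'] at hmono
  refine hmono.trans_eq ?_
  simp only [kerForm, sqNorm, secondMoment]
  ring

theorem exists_isCutoff {d : ℝ} (hd : 0 < d) (E : Set (V n)) :
    ∃ η : V n → ℝ, IsCutoff d⁻¹ η ∧ (∀ x ∈ E, η x = 1) ∧ ∀ x, x ∉ thickening d E → η x = 0 := by
  refine ⟨fun x => (thickenedIndicator hd E x : ℝ), ⟨fun x => NNReal.coe_nonneg _,
    fun x => by exact_mod_cast thickenedIndicator_le_one hd E x, fun x y => ?_, ?_⟩,
    fun x hx => by simp [thickenedIndicator_one hd E hx],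
    fun x hx => by simp [thickenedIndicator_zero hd E hx]⟩
  · have := (lipschitzWith_thickenedIndicator hd E).dist_le_mul x y
    rw [NNReal.dist_eq, dist_eq_norm] at this
    simpa [hd.le] using this
  · exact (NNReal.continuous_coe.comp (thickenedIndicator hd E).continuous).measurable

theorem mul_incr_congr_of_near {d : ℝ} {κ : V n × V n → ℝ} {u w φ : V n → ℝ} {E : Set (V n)}
    (hκ : ∀ p : V n × V n, d ≤ ‖p.1 - p.2‖ → κ p = 0) (hφ : ∀ x, x ∉ E → φ x = 0)
    (huw : ∀ x ∈ thickening d E, u x = w x) (p : V n × V n) :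
    incr u p * incr φ p * κ p = incr w p * incr φ p * κ p := by
  rcases le_or_gt d ‖p.1 - p.2‖ with h | h
  · simp [hκ p h]
  have hd : 0 < d := (norm_nonneg _).trans_lt h
  by_cases h1 : p.1 ∈ E
  · have h2 : p.2 ∈ thickening d E :=
      mem_thickening_iff.2 ⟨p.1, h1, by rwa [dist_comm, dist_eq_norm]⟩
    simp [incr, huw _ h2, huw _ (self_subset_thickening hd E h1)]
  by_cases h2 : p.2 ∈ E
  · have h1 : p.1 ∈ thickening d E := mem_thickening_iff.2 ⟨p.2, h2, by rwa [dist_eq_norm]⟩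
    simp [incr, huw _ h1, huw _ (self_subset_thickening hd E h2)]
  · simp [incr, hφ _ h1, hφ _ h2]

theorem kerForm_congr_of_near {d : ℝ} {κ : V n × V n → ℝ} {u w φ : V n → ℝ} {E : Set (V n)}
    (hκ : ∀ p : V n × V n, d ≤ ‖p.1 - p.2‖ → κ p = 0) (hφ : ∀ x, x ∉ E → φ x = 0)
    (huw : ∀ x ∈ thickening d E, u x = w x) : kerForm κ u φ = kerForm κ w φ :=
  integral_congr_ae (Filter.Eventually.of_forall (mul_incr_congr_of_near hκ hφ huw))

/-- A measurable kernel supported near the diagonal and comparable there to `|x-y|^{-a}`. -/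
structure IsNearKernel (d a lam Lam : ℝ) (κ : V n × V n → ℝ) : Prop where
  aesm : AEStronglyMeasurable κ
  support : ∀ p : V n × V n, d ≤ ‖p.1 - p.2‖ → κ p = 0
  bounds : ∀ᵐ p : V n × V n,
    lam * riesz d a (p.1 - p.2) ≤ κ p ∧ κ p ≤ Lam * riesz d a (p.1 - p.2)

theorem IsNearKernel.abs_le {d a lam Lam : ℝ} {κ : V n × V n → ℝ}
    (hκ : IsNearKernel d a lam Lam κ) (hlam : 0 ≤ lam) :
    ∀ᵐ p : V n × V n, |κ p| ≤ Lam * riesz d a (p.1 - p.2) := by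
  filter_upwards [hκ.bounds] with p hp
  rw [abs_of_nonneg ((mul_nonneg hlam (riesz_nonneg _ _ _)).trans hp.1)]
  exact hp.2

theorem kerForm_sub_right {d a c : ℝ} {κ : V n × V n → ℝ} {u φ ψ : V n → ℝ} (hc : 0 ≤ c)
    (hκm : AEStronglyMeasurable κ) (hκ : ∀ᵐ p, |κ p| ≤ c * riesz d a (p.1 - p.2))
    (hu : FiniteEnergy d a u) (hφ : FiniteEnergy d a φ) (hψ : FiniteEnergy d a ψ) :
    kerForm κ u (fun x => φ x - ψ x) = kerForm κ u φ - kerForm κ u ψ := by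
  unfold kerForm
  rw [← integral_sub (integrable_kerForm hc hκm hκ hu hφ).1
    (integrable_kerForm hc hκm hκ hu hψ).1]
  congr 1 with p
  simp only [incr]; ring

theorem kerForm_sub_left {d a c : ℝ} {κ : V n × V n → ℝ} {u v φ : V n → ℝ} (hc : 0 ≤ c)
    (hκm : AEStronglyMeasurable κ) (hκ : ∀ᵐ p, |κ p| ≤ c * riesz d a (p.1 - p.2))
    (hu : FiniteEnergy d a u) (hv : FiniteEnergy d a v) (hφ : FiniteEnergy d a φ) :
    kerForm κ (fun x => u x - v x) φ = kerForm κ u φ - kerForm κ v φ := by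
  unfold kerForm
  rw [← integral_sub (integrable_kerForm hc hκm hκ hu hφ).1
    (integrable_kerForm hc hκm hκ hv hφ).1]
  congr 1 with p
  simp only [incr]; ring

theorem kerForm_shift_sub {d a lam Lam ε : ℝ} {κ : V n × V n → ℝ} {u φ : V n → ℝ} {z : V n}
    (hlam : 0 ≤ lam) (hLam : 0 ≤ Lam) (hε : 0 ≤ ε) (hκ : IsNearKernel d a lam Lam κ)
    (hz : ∀ᵐ p : V n × V n, |κ (p.1 + -z, p.2 + -z) - κ p| ≤ ε * riesz d a (p.1 - p.2))
    (hu : FiniteEnergy d a u) (hφ : FiniteEnergy d a φ) :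
    kerForm κ (fun x => u (x + z) - u x) φ ≤
      kerForm κ u (fun x => φ (x + -z) - φ x) +
        ε * (√(nearEnergy d a u) * √(nearEnergy d a φ)) := by
  have hb := hκ.abs_le hlam
  have hφ' := hφ.shift (-z)
  have hm' : AEStronglyMeasurable fun p : V n × V n => κ (p.1 + -z, p.2 + -z) :=
    hκ.aesm.comp_measurePreserving (measurePreserving_add_diag (-z))
  rw [kerForm_sub_left hLam hκ.aesm hb (hu.shift z) hu hφ,
    kerForm_sub_right hLam hκ.aesm hb hu hφ' hφ]
  obtain ⟨hi, hle⟩ := integrable_kerForm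
    (κ := fun p => κ (p.1 + -z, p.2 + -z) - κ p) hε (hm'.sub hκ.aesm) hz hu hφ'
  rw [nearEnergy_shift] at hle
  have e1 : kerForm κ (fun x => u (x + z)) φ =
      kerForm (fun p => κ (p.1 + -z, p.2 + -z)) u (fun x => φ (x + -z)) := by
    unfold kerForm
    rw [← integral_comp_add_diag (fun p => incr u p * incr (fun x => φ (x + -z)) p *
      κ (p.1 + -z, p.2 + -z)) z]
    simp [incr]
  have e2 : kerForm (fun p => κ (p.1 + -z, p.2 + -z)) u (fun x => φ (x + -z)) =
      kerForm κ u (fun x => φ (x + -z)) +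
        kerForm (fun p => κ (p.1 + -z, p.2 + -z) - κ p) u (fun x => φ (x + -z)) := by
    unfold kerForm
    rw [← integral_add (integrable_kerForm hLam hκ.aesm hb hu hφ').1 hi]
    congr 1 with p
    ring
  rw [e1, e2]
  have := (le_abs_self _).trans hle
  linarith

theorem second_difference_estimate (hn : 1 ≤ n) {s d lam Lam ε : ℝ} (hs : s ∈ Ioo (0 : ℝ) 1)
    (hd : 0 < d) (hlam : 0 < lam) (hLam : 0 ≤ Lam) (hε : 0 ≤ ε) :
    ∃ C > 0, ∀ (κ : V n × V n → ℝ) (E : Set (V n)) (u : V n → ℝ) (N : ℝ),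
      IsNearKernel d ((n : ℝ) + 2 * s) lam Lam κ → 0 ≤ N →
      FiniteEnergy d ((n : ℝ) + 2 * s) u → sqNorm u ≤ N ^ 2 →
      (∀ φ, FiniteEnergy d ((n : ℝ) + 2 * s) φ → (∀ x, x ∉ thickening (4 * d) E → φ x = 0) →
        kerForm κ u φ ≤ N * √(sqNorm φ)) →
      ∀ z : V n, z ≠ 0 → 2 * ‖z‖ ≤ d →
        (∀ᵐ p : V n × V n, |κ (p.1 + -z, p.2 + -z) - κ p| ≤
          ε * ‖z‖ ^ s * riesz d ((n : ℝ) + 2 * s) (p.1 - p.2)) →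
        ∃ w : V n → ℝ, Measurable w ∧ Integrable (fun x => w x ^ 2) ∧
          sqNorm w ≤ C * (‖z‖ ^ (2 * s)) ^ 2 * N ^ 2 ∧
          ∀ x ∈ shift2 E z, w x = diff2 z u x := by
  set a : ℝ := (n : ℝ) + 2 * s
  obtain ⟨c, hc, hemb⟩ := sqNorm_sub_shift_le (d := d) hn hs.1
  have hq : Integrable fun x : V n => ‖x‖ ^ 2 * riesz d a x := integrable_sq_mul_riesz hn d hs.2
  set m := secondMoment n d a
  have hm : 0 ≤ m := secondMoment_nonneg d a
  set L : ℝ := d⁻¹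
  obtain ⟨g, hg⟩ : ∃ g, g = (1 + Lam * L ^ 2 * m) / lam := ⟨_, rfl⟩
  have hg0 : 0 < g := by rw [hg]; positivity
  obtain ⟨B, hB⟩ : ∃ B, B = √c + ε * √g := ⟨_, rfl⟩
  have hB0 : 0 ≤ B := by rw [hB]; positivity
  obtain ⟨D, hD⟩ : ∃ D, D = Lam * L ^ 2 * (c * g * m) := ⟨_, rfl⟩
  have hD0 : 0 ≤ D := by rw [hD]; positivity
  obtain ⟨F, hF⟩ : ∃ F, F = 2 * L ^ 2 * (c * g * m) := ⟨_, rfl⟩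
  have hF0 : 0 ≤ F := by rw [hF]; positivity
  obtain ⟨Q, hQ⟩ : ∃ Q, Q = 2 / lam * (lam * F / 4 + B ^ 2 / lam + D) + 1 := ⟨_, rfl⟩
  have hQ0 : 0 < Q := by rw [hQ]; positivity
  refine ⟨c * Q, by positivity, fun κ E u N hκ hN hu huN hsol z hz hzd hzκ => ?_⟩
  have hz0 : 0 < ‖z‖ := norm_pos_iff.2 hz
  obtain ⟨Z, hZ⟩ : ∃ Z, Z = ‖z‖ ^ s := ⟨_, rfl⟩
  have hZ0 : 0 < Z := by rw [hZ]; positivity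
  have hZ2 : ‖z‖ ^ (2 * s) = Z ^ 2 := by
    rw [hZ, ← Real.rpow_natCast, ← Real.rpow_mul hz0.le]; congr 1; push_cast; ring
  rw [← hZ] at hzκ
  rw [hZ2]
  -- the energy estimate for the localized solution
  obtain ⟨η, hη, hη1, hη0⟩ := exists_isCutoff hd (thickening (3 * d) E)
  have hsub34 : thickening d (thickening (3 * d) E) ⊆ thickening (4 * d) E :=
    (thickening_thickening_subset _ _ _).trans_eq (by ring_nf)
  set u₁ : V n → ℝ := fun x => η x * u x with hu₁
  have hu₁E : FiniteEnergy d a u₁ := (hu.cutoff_mul hq hη).1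
  have hφ₁E := (hu₁E.cutoff_mul hq hη).1
  have hG : nearEnergy d a u₁ ≤ g * N ^ 2 := by
    have h1 := nearEnergy_cutoff_le_kerForm hq hη hlam.le hκ.aesm hκ.bounds hLam hu
    have h2 := hsol (fun x => η x * u₁ x) hφ₁E
      (fun x hx => by rw [hη0 x fun h => hx (hsub34 h), zero_mul])
    have h3 : √(sqNorm fun x => η x * u₁ x) ≤ N := by
      refine Real.sqrt_le_iff.2 ⟨hN, ?_⟩
      exact ((hη.sqNorm_mul_le hu₁E.measurable hu₁E.sq).trans
        (hη.sqNorm_mul_le hu.measurable hu.sq)).trans huN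
    have h4 := mul_le_mul_of_nonneg_left h3 hN
    have h5 : Lam * L ^ 2 * (sqNorm u * m) ≤ Lam * L ^ 2 * (N ^ 2 * m) := by gcongr
    rw [hg, div_mul_eq_mul_div, le_div_iff₀ hlam]
    linarith
  have hG0 := nearEnergy_nonneg d a u₁
  -- the first difference
  set v : V n → ℝ := fun x => u₁ (x + z) - u₁ x with hv
  have hvE : FiniteEnergy d a v := (hu₁E.shift z).sub hu₁E
  have hvN : sqNorm v ≤ c * g * (Z ^ 2 * N ^ 2) := by
    have := hemb u₁ hu₁E z hz hzd
    rw [hZ2] at this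
    refine this.trans ((mul_le_mul_of_nonneg_left hG (by positivity)).trans_eq (by ring))
  obtain ⟨θ, hθ, hθ1, hθ0⟩ := exists_isCutoff hd E
  set w : V n → ℝ := fun x => θ x * v x with hw
  have hwE : FiniteEnergy d a w := (hvE.cutoff_mul hq hθ).1
  set φ : V n → ℝ := fun x => θ x * w x with hφ
  obtain ⟨hφE, hφG⟩ := hwE.cutoff_mul hq hθ
  have hφ0 : ∀ x, x ∉ thickening d E → φ x = 0 := fun x hx => by simp [hφ, hθ0 x hx]
  obtain ⟨X, hX⟩ : ∃ X, X = nearEnergy d a w := ⟨_, rfl⟩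
  obtain ⟨Y, hY⟩ : ∃ Y, Y = nearEnergy d a φ := ⟨_, rfl⟩
  have hX0 : 0 ≤ X := hX ▸ nearEnergy_nonneg _ _ _
  have hY0 : 0 ≤ Y := hY ▸ nearEnergy_nonneg _ _ _
  have hYX : Y ≤ 2 * X + F * (Z ^ 2 * N ^ 2) := by
    have h1 : sqNorm w ≤ c * g * (Z ^ 2 * N ^ 2) :=
      (hθ.sqNorm_mul_le hvE.measurable hvE.sq).trans hvN
    have h2 : 2 * L ^ 2 * (sqNorm w * m) ≤ 2 * L ^ 2 * (c * g * (Z ^ 2 * N ^ 2) * m) := by gcongr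
    rw [hY, hX, hF]
    linarith
  have hXB : lam * X ≤ B * (N * Z) * √Y + D * (Z ^ 2 * N ^ 2) := by
    have h1 := nearEnergy_cutoff_le_kerForm hq hθ hlam.le hκ.aesm hκ.bounds hLam hvE
    have h2 := kerForm_shift_sub hlam.le hLam (by positivity) hκ hzκ hu₁E hφE
    have hψE : FiniteEnergy d a fun x => φ (x + -z) - φ x := (hφE.shift (-z)).sub hφE
    have hψ0 : ∀ x, x ∉ thickening (2 * d) E → φ (x + -z) - φ x = 0 := fun x hx => by
      rw [hφ0 x fun h => hx (thickening_mono (by linarith) E h), sub_zero]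
      refine hφ0 _ fun h => hx ?_
      obtain ⟨y, hy, hxy⟩ := mem_thickening_iff.1 h
      refine mem_thickening_iff.2 ⟨y, hy, ?_⟩
      have := dist_triangle x (x + -z) y
      have h' : dist x (x + -z) = ‖z‖ := by simp [dist_eq_norm]
      linarith
    have h3 : kerForm κ u₁ (fun x => φ (x + -z) - φ x) =
        kerForm κ u (fun x => φ (x + -z) - φ x) := by
      refine kerForm_congr_of_near hκ.support hψ0 fun x hx => ?_
      have : x ∈ thickening (3 * d) E := by
        have := thickening_thickening_subset d (2 * d) E hx
        rwa [show d + 2 * d = 3 * d by ring] at this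
      simp [hu₁, hη1 x this]
    have h4 := hsol _ hψE fun x hx => hψ0 x fun h => hx (thickening_mono (by linarith) E h)
    have h5 := hemb φ hφE (-z) (neg_ne_zero.2 hz) (by rwa [norm_neg])
    rw [norm_neg, hZ2, ← hY] at h5
    have h6 : √(sqNorm fun x => φ (x + -z) - φ x) ≤ √c * Z * √Y := by
      refine (Real.sqrt_le_sqrt h5).trans_eq ?_
      rw [Real.sqrt_mul (by positivity), Real.sqrt_mul hc.le, Real.sqrt_sq hZ0.le]
    have h7 : √(nearEnergy d a u₁) ≤ √g * N := by
      refine (Real.sqrt_le_sqrt hG).trans_eq ?_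
      rw [Real.sqrt_mul hg0.le, Real.sqrt_sq hN]
    have h8 := mul_le_mul_of_nonneg_left h6 hN
    have h9 : ε * Z * (√(nearEnergy d a u₁) * √Y) ≤ ε * Z * (√g * N * √Y) := by gcongr
    have h10 : Lam * L ^ 2 * (sqNorm v * m) ≤ Lam * L ^ 2 * (c * g * (Z ^ 2 * N ^ 2) * m) := by
      gcongr
    rw [← hY] at h2
    rw [hX, hB, hD]
    linarith
  have hXQ : X ≤ Q * (Z ^ 2 * N ^ 2) := by
    have h1 : B * (N * Z) * √Y ≤ lam / 4 * Y + B ^ 2 / lam * (Z ^ 2 * N ^ 2) := by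
      have h2 : 0 ≤ (lam / 2 * √Y - B * (N * Z)) ^ 2 / lam := by positivity
      have h3 : (lam / 2 * √Y - B * (N * Z)) ^ 2 / lam =
          lam / 4 * √Y ^ 2 - B * (N * Z) * √Y + B ^ 2 / lam * (Z ^ 2 * N ^ 2) := by
        field_simp; ring
      rw [h3, Real.sq_sqrt hY0] at h2
      linarith
    have h2 := mul_le_mul_of_nonneg_left hYX (by positivity : 0 ≤ lam / 4)
    have h3 : lam / 2 * X ≤ (lam * F / 4 + B ^ 2 / lam + D) * (Z ^ 2 * N ^ 2) := by linarith
    have h4 := mul_le_mul_of_nonneg_left h3 (by positivity : 0 ≤ 2 / lam)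
    have h5 : 2 / lam * (lam / 2 * X) = X := by field_simp
    have h6 : 0 ≤ Z ^ 2 * N ^ 2 := by positivity
    rw [hQ]
    rw [h5] at h4
    linarith
  -- the second difference
  refine ⟨fun x => w (x + z) - w x, ((hwE.shift z).sub hwE).measurable,
    ((hwE.shift z).sub hwE).sq, ?_, fun x hx => ?_⟩
  · have := hemb w hwE z hz hzd
    rw [hZ2, ← hX] at this
    refine this.trans ((mul_le_mul_of_nonneg_left hXQ (by positivity)).trans_eq (by ring))
  · obtain ⟨hx0, hx1, hx2⟩ := hx
    have hE : ∀ y ∈ E, η y = 1 := fun y hy =>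
      hη1 y (self_subset_thickening (by positivity) E hy)
    have e : x + z + z = x + 2 • z := by rw [two_smul, add_assoc]
    simp only [hw, hv, hu₁, hθ1 _ hx0, hθ1 _ hx1, e, hE _ hx0, hE _ hx1, hE _ hx2, diff2]
    ring

/-- The restriction of a kernel to `|x - y| < d`. -/
def nearKer (d : ℝ) (K : V n → V n → ℝ) (p : V n × V n) : ℝ :=
  if ‖p.1 - p.2‖ < d then K p.1 p.2 else 0

/-- The restriction of a kernel to `|x - y| ≥ d`. -/
def farKer (d : ℝ) (K : V n → V n → ℝ) (p : V n × V n) : ℝ :=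
  if ‖p.1 - p.2‖ < d then 0 else K p.1 p.2

theorem nearKer_add_farKer (d : ℝ) (K : V n → V n → ℝ) (p : V n × V n) :
    nearKer d K p + farKer d K p = K p.1 p.2 := by
  unfold nearKer farKer; split_ifs <;> simp

theorem measurableSet_norm_sub_lt (d : ℝ) : MeasurableSet {p : V n × V n | ‖p.1 - p.2‖ < d} :=
  measurableSet_lt (by fun_prop) measurable_const

theorem measurable_nearKer (d : ℝ) {K : V n → V n → ℝ} (hK : Measurable (Function.uncurry K)) :
    Measurable (nearKer d K) :=
  Measurable.ite (measurableSet_norm_sub_lt d) hK measurable_const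

theorem measurable_farKer (d : ℝ) {K : V n → V n → ℝ} (hK : Measurable (Function.uncurry K)) :
    Measurable (farKer d K) :=
  Measurable.ite (measurableSet_norm_sub_lt d) measurable_const hK

section Kernel

variable {s β lam Lam M Gam d : ℝ} {K : V n → V n → ℝ}

theorem KBounds.ae_norm_sub_pos (hK : KBounds s β lam Lam M K) (hs : 0 < s) (hlam : 0 < lam) :
    ∀ᵐ p : V n × V n, 0 < ‖p.1 - p.2‖ := by
  filter_upwards [hK.1] with p hp
  refine (norm_nonneg _).lt_of_ne fun h => ?_
  have := (hp (by rw [← h]; exact one_pos)).1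
  rw [← h, Real.zero_rpow (by positivity), zero_mul] at this
  linarith

theorem isNearKernel_nearKer (hm : Measurable (Function.uncurry K))
    (hK : KBounds s β lam Lam M K) (hs : 0 < s) (hlam : 0 < lam) (hd1 : d ≤ 1) :
    IsNearKernel d ((n : ℝ) + 2 * s) lam Lam (nearKer d K) := by
  refine ⟨(measurable_nearKer d hm).aestronglyMeasurable,
    fun p hp => if_neg (not_lt.2 hp), ?_⟩
  filter_upwards [hK.1, hK.ae_norm_sub_pos hs hlam] with p hp h0
  unfold nearKer riesz
  split_ifs with h
  · have hp := hp (h.trans_le hd1)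
    have hpos : 0 < ‖p.1 - p.2‖ ^ ((n : ℝ) + 2 * s) := by positivity
    rw [Real.rpow_neg h0.le, ← div_eq_mul_inv, ← div_eq_mul_inv, div_le_iff₀ hpos,
      le_div_iff₀ hpos, mul_comm (K p.1 p.2)]
    exact hp
  · simp

theorem KHolder.nearKer_shift_le (hH : KHolder s Gam K) (hK : KBounds s β lam Lam M K)
    (hs : s ∈ Ioo (0 : ℝ) 1) (hlam : 0 < lam) (hGam : 0 ≤ Gam) (hd1 : d ≤ 1) {z : V n}
    (hz0 : z ≠ 0) (hz : 2 * ‖z‖ < 1) :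
    ∀ᵐ p : V n × V n, |nearKer d K (p.1 + z, p.2 + z) - nearKer d K p| ≤
      3 * Gam * ‖z‖ ^ s * riesz d ((n : ℝ) + 2 * s) (p.1 - p.2) := by
  have hzp : 0 < ‖z‖ := norm_pos_iff.2 hz0
  have hA : ∀ᵐ y : V n, ∀ᵐ p : V n × V n, ‖p.1 - p.2‖ < 1 → ‖y‖ < 1 →
      ‖p.1 - p.2‖ ^ ((n : ℝ) + 2 * s) * |K (p.1 + y) (p.2 + y) - K p.1 p.2| ≤ Gam * ‖y‖ ^ s :=
    Measure.ae_ae_of_ae_prod hH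
  have hB := (Measure.measurePreserving_sub_left
    (volume : Measure (V n)) z).quasiMeasurePreserving.ae hA
  have hne : (ae (volume.restrict (ball (0 : V n) ‖z‖))).NeBot :=
    ae_restrict_neBot.2 (measure_ball_pos _ _ hzp).ne'
  obtain ⟨y, hy, hyA, hyB⟩ := ((ae_restrict_mem measurableSet_ball).and
    (ae_restrict_of_ae (hA.and hB))).exists (f := ae (volume.restrict (ball (0 : V n) ‖z‖)))
  rw [mem_ball_zero_iff] at hy
  have hzy : ‖z - y‖ ≤ 2 * ‖z‖ := by have := norm_sub_le z y; linarith
  filter_upwards [hyA, (measurePreserving_add_diag y).quasiMeasurePreserving.ae hyB,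
    hK.ae_norm_sub_pos hs.1 hlam] with p h1 h2 h0
  unfold nearKer riesz
  have e : p.1 + z - (p.2 + z) = p.1 - p.2 := by abel
  simp only [e]
  split_ifs with h
  · have h1 := h1 (h.trans_le hd1) (by linarith)
    simp only [add_sub_add_right_eq_sub, add_assoc, add_sub_cancel] at h2
    have h2 := h2 (h.trans_le hd1) (by linarith)
    have hpos : 0 < ‖p.1 - p.2‖ ^ ((n : ℝ) + 2 * s) := by positivity
    rw [Real.rpow_neg h0.le, ← div_eq_mul_inv, le_div_iff₀ hpos, mul_comm]
    have h3 : ‖y‖ ^ s ≤ ‖z‖ ^ s := Real.rpow_le_rpow (norm_nonneg _) hy.le hs.1.le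
    have h4 : ‖z - y‖ ^ s ≤ 2 * ‖z‖ ^ s := by
      refine (Real.rpow_le_rpow (norm_nonneg _) hzy hs.1.le).trans ?_
      rw [Real.mul_rpow (by norm_num) hzp.le]
      gcongr
      exact (Real.rpow_le_rpow_of_exponent_le (by norm_num) hs.2.le).trans_eq (Real.rpow_one 2)
    have h5 := abs_sub_le (K (p.1 + z) (p.2 + z)) (K (p.1 + y) (p.2 + y)) (K p.1 p.2)
    have h6 := mul_le_mul_of_nonneg_left h5 hpos.le
    have h7 := mul_le_mul_of_nonneg_left h3 hGam
    have h8 := mul_le_mul_of_nonneg_left h4 hGam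
    linarith
  · simp

theorem KBounds.farKer_le (hK : KBounds s β lam Lam M K) (hs : 0 < s) (hβ : 0 < β)
    (hLam : 0 ≤ Lam) (hM : 0 ≤ M) (hK0 : ∀ x y, 0 ≤ K x y) (hd : 0 < d) :
    ∀ᵐ p : V n × V n, |farKer d K p| ≤
      (2 * Lam * d ^ (-((n : ℝ) + 2 * s)) + 2 * M) * weight ((n : ℝ) + β) (p.1 - p.2) := by
  filter_upwards [hK.1, hK.2] with p h1 h2
  have hw := weight_pos ((n : ℝ) + β) (p.1 - p.2)
  unfold farKer
  split_ifs with h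
  · rw [abs_zero]; positivity
  rw [abs_of_nonneg (hK0 _ _)]
  have h0 : 0 < ‖p.1 - p.2‖ := hd.trans_le (not_lt.1 h)
  have hk := hK0 p.1 p.2
  rcases lt_or_ge ‖p.1 - p.2‖ 1 with h3 | h3
  · have h4 := (h1 h3).2
    have h5 : d ^ ((n : ℝ) + 2 * s) * K p.1 p.2 ≤ Lam := by
      refine le_trans ?_ h4
      gcongr
      exact not_lt.1 h
    have h6 : K p.1 p.2 ≤ Lam * d ^ (-((n : ℝ) + 2 * s)) := by
      rw [Real.rpow_neg hd.le, ← div_eq_mul_inv, le_div_iff₀ (by positivity), mul_comm]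
      exact h5
    have h7 : 1 ≤ 2 * weight ((n : ℝ) + β) (p.1 - p.2) := by
      rw [weight, mul_one_div, one_le_div (by positivity)]
      linarith [Real.rpow_le_one h0.le h3.le (by positivity : 0 ≤ (n : ℝ) + β)]
    have h8 : 0 ≤ Lam * d ^ (-((n : ℝ) + 2 * s)) := by positivity
    nlinarith [mul_le_mul_of_nonneg_left h7 h8]
  · have h4 := (h2 h3).2
    have h5 : 1 ≤ ‖p.1 - p.2‖ ^ ((n : ℝ) + β) := Real.one_le_rpow h3 (by positivity)
    have h6 : K p.1 p.2 ≤ 2 * M * weight ((n : ℝ) + β) (p.1 - p.2) := by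
      rw [weight, mul_one_div, le_div_iff₀ (by positivity)]
      nlinarith
    have h8 : 0 ≤ 2 * Lam * d ^ (-((n : ℝ) + 2 * s)) * weight ((n : ℝ) + β) (p.1 - p.2) := by
      positivity
    linarith

end Kernel

theorem L2norm_eq_sqrt (A : Set (V n)) (u : V n → ℝ) : L2norm A u = √(∫ x in A, u x ^ 2) := by
  rw [L2norm, Real.sqrt_eq_rpow]

theorem integrable_mul_of_zero_outside {Ω : Set (V n)} {u φ : V n → ℝ}
    (hum : Measurable u) (hu : IntegrableOn (fun x => u x ^ 2) Ω) (hφm : Measurable φ)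
    (hφ : Integrable fun x => φ x ^ 2) (hφ0 : ∀ x, x ∉ Ω → φ x = 0) :
    Integrable (fun x => u x * φ x) ∧ ∫ x, |u x * φ x| ≤ L2norm Ω u * √(sqNorm φ) := by
  obtain ⟨h1, h2⟩ := abs_integral_mul_le_sqrt (μ := volume.restrict Ω)
    hum.aestronglyMeasurable hφm.aestronglyMeasurable hu hφ.integrableOn
  have e : ∀ x, x ∉ Ω → u x * φ x = 0 := fun x hx => by rw [hφ0 x hx, mul_zero]
  refine ⟨(integrableOn_iff_integrable_of_support_subset fun x hx => ?_).1 h1, ?_⟩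
  · by_contra h
    exact hx (e x h)
  · rw [setIntegral_eq_integral_of_forall_compl_eq_zero (fun x hx => by rw [e x hx, abs_zero]),
      setIntegral_eq_integral_of_forall_compl_eq_zero (f := fun x => φ x ^ 2)
        (fun x hx => by simp [hφ0 x hx])] at h2
    rw [L2norm_eq_sqrt]
    exact h2

theorem far_form_estimate {β : ℝ} (hβ : 0 < β) (Ω : Set (V n)) (R : ℝ) :
    ∃ C ≥ 0, ∀ u φ : V n → ℝ, Measurable u → IntegrableOn (fun x => u x ^ 2) Ω →
      HasFiniteWnorm β 0 u → Measurable φ → Integrable (fun x => φ x ^ 2) →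
      (∀ x, x ∉ Ω → φ x = 0) → (∀ x, R < ‖x‖ → φ x = 0) →
      Integrable (fun p : V n × V n =>
        |incr u p * incr φ p| * weight ((n : ℝ) + β) (p.1 - p.2)) ∧
      ∫ p : V n × V n, |incr u p * incr φ p| * weight ((n : ℝ) + β) (p.1 - p.2) ≤
        C * (L2norm Ω u + wnorm β 0 u) * √(sqNorm φ) := by
  set a : ℝ := (n : ℝ) + β with ha
  have ha0 : 0 ≤ a := by positivity
  have hw : Integrable (weight a : V n → ℝ) := integrable_weight hβ
  set I : ℝ := ∫ x : V n, weight a x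
  have hI : 0 ≤ I := integral_nonneg fun x => (weight_pos a x).le
  set Q : ℝ := 1 + 2 ^ a + 2 ^ a * |R| ^ a
  have hQ : 0 ≤ Q := by positivity
  set T : ℝ := L2norm (closedBall (0 : V n) R) fun _ => 1
  have hT : 0 ≤ T := by unfold T L2norm; positivity
  refine ⟨2 * I + 2 * Q * T, by positivity,
    fun u φ hum hu huw hφm hφ hφΩ hφR => ?_⟩
  obtain ⟨h1, h1'⟩ := integrable_mul_of_zero_outside hum hu hφm hφ hφΩ
  obtain ⟨h2, h2'⟩ := integrable_mul_of_zero_outside (Ω := closedBall (0 : V n) R)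
    (u := fun _ => (1 : ℝ)) measurable_const
    (by simpa using (measure_closedBall_lt_top : volume (closedBall (0 : V n) R) < ⊤)) hφm hφ
    (fun x hx => hφR x (by simpa using hx))
  simp only [one_mul] at h2 h2'
  obtain ⟨A1, A1'⟩ := integrable_fst_mul_sub h1.abs hw (weight_neg a)
  obtain ⟨A2, A2'⟩ := integrable_snd_mul_sub h1.abs hw
  have huw' : Integrable fun x => |u x| * weight a x := by
    refine huw.congr (Filter.Eventually.of_forall fun x => ?_)
    simp [weight, div_eq_mul_inv, ha]
  have hwn : ∫ x, |u x| * weight a x = wnorm β 0 u := by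
    simp [wnorm, weight, div_eq_mul_inv, ha]
  have hwn0 : 0 ≤ wnorm β 0 u :=
    hwn ▸ integral_nonneg fun x => mul_nonneg (abs_nonneg _) (weight_pos a x).le
  have B1 : Integrable fun p : V n × V n => |φ p.1| * (|u p.2| * weight a p.2) :=
    h2.abs.mul_prod huw'
  have B2 : Integrable fun p : V n × V n => (|u p.1| * weight a p.1) * |φ p.2| :=
    huw'.mul_prod h2.abs
  have B1' : ∫ p : V n × V n, |φ p.1| * (|u p.2| * weight a p.2) = (∫ x, |φ x|) * wnorm β 0 u := by
    rw [← hwn]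
    exact integral_prod_mul (μ := (volume : Measure (V n))) (ν := (volume : Measure (V n)))
      (fun x => |φ x|) (fun x => |u x| * weight a x)
  have B2' : ∫ p : V n × V n, (|u p.1| * weight a p.1) * |φ p.2| = wnorm β 0 u * ∫ x, |φ x| := by
    rw [← hwn]
    exact integral_prod_mul (μ := (volume : Measure (V n))) (ν := (volume : Measure (V n)))
      (fun x => |u x| * weight a x) (fun x => |φ x|)
  have hcross : ∀ x y : V n, |φ x| * weight a (x - y) ≤ Q * (|φ x| * weight a y) := fun x y => by
    rcases le_or_gt ‖x‖ R with hx | hx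
    · have hR : |R| = R := abs_of_nonneg ((norm_nonneg _).trans hx)
      have := mul_le_mul_of_nonneg_left (weight_sub_le ha0 (hx.trans_eq hR.symm) y)
        (abs_nonneg (φ x))
      linarith
    · simp [hφR x hx]
  have hsum := (A1.add A2).add ((B1.add B2).const_mul Q)
  have hle : ∀ p : V n × V n, |incr u p * incr φ p| * weight a (p.1 - p.2) ≤
      (|u p.1 * φ p.1| * weight a (p.1 - p.2) + |u p.2 * φ p.2| * weight a (p.1 - p.2)) +
        Q * (|φ p.1| * (|u p.2| * weight a p.2) + |u p.1| * weight a p.1 * |φ p.2|) := fun p => by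
    have hw0 := (weight_pos a (p.1 - p.2)).le
    have k1 : |incr u p * incr φ p| ≤ (|u p.1| + |u p.2|) * (|φ p.1| + |φ p.2|) := by
      rw [abs_mul]
      exact mul_le_mul (abs_sub _ _) (abs_sub _ _) (abs_nonneg _) (by positivity)
    have k2 := mul_le_mul_of_nonneg_right k1 hw0
    have k3 := mul_le_mul_of_nonneg_left (hcross p.1 p.2) (abs_nonneg (u p.2))
    have k4 := mul_le_mul_of_nonneg_left (hcross p.2 p.1) (abs_nonneg (u p.1))
    rw [← neg_sub p.1 p.2, weight_neg] at k4
    rw [abs_mul (u p.1), abs_mul (u p.2)]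
    linarith
  have hint : Integrable fun p : V n × V n =>
      |incr u p * incr φ p| * weight a (p.1 - p.2) := by
    refine hsum.mono' (((measurable_incr hum).mul (measurable_incr hφm)).abs.mul
      ((measurable_weight a).comp (by fun_prop))).aestronglyMeasurable
      (Filter.Eventually.of_forall fun p => ?_)
    rw [Real.norm_of_nonneg (mul_nonneg (abs_nonneg _) (weight_pos _ _).le)]
    exact hle p
  refine ⟨hint, (integral_mono hint hsum hle).trans ?_⟩
  simp only [Pi.add_apply]
  have hA : Integrable fun p : V n × V n =>
    |u p.1 * φ p.1| * weight a (p.1 - p.2) + |u p.2 * φ p.2| * weight a (p.1 - p.2) := A1.add A2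
  have hB : Integrable fun p : V n × V n =>
    Q * (|φ p.1| * (|u p.2| * weight a p.2) + |u p.1| * weight a p.1 * |φ p.2|) :=
    (B1.add B2).const_mul Q
  rw [integral_add hA hB, integral_const_mul, integral_add A1 A2, integral_add B1 B2, A1', A2',
    B1', B2']
  have k1 := mul_le_mul_of_nonneg_right h1' hI
  have k2 := mul_le_mul_of_nonneg_right h2' (mul_nonneg hQ hwn0)
  have k3 : 0 ≤ L2norm Ω u := by rw [L2norm_eq_sqrt]; positivity
  have k4 : 0 ≤ √(sqNorm φ) := Real.sqrt_nonneg _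
  have k5 : 0 ≤ I * wnorm β 0 u * √(sqNorm φ) := by positivity
  have k6 : 0 ≤ Q * T * L2norm Ω u * √(sqNorm φ) := by positivity
  change _ * I + _ * I + _ ≤ _
  linarith

section Localization

variable {s β lam Lam M Gam d : ℝ} {K : V n → V n → ℝ}

theorem measurableSet_crossSet {Ω : Set (V n)} (hΩ : MeasurableSet Ω) :
    MeasurableSet (crossSet Ω) :=
  (hΩ.preimage measurable_fst).union (hΩ.preimage measurable_snd)

theorem mem_of_near {Ω E : Set (V n)} (hE : thickening d E ⊆ Ω) {x y : V n} (hx : x ∈ E)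
    (h : ‖x - y‖ < d) : x ∈ Ω ∧ y ∈ Ω :=
  ⟨hE (self_subset_thickening ((norm_nonneg _).trans_lt h) _ hx),
    hE (mem_thickening_iff.2 ⟨x, hx, by rwa [dist_comm, dist_eq_norm]⟩)⟩

/-- Cutting off a function of `X(Ω)` inside `Ω` gives a function of finite energy. -/
theorem MemX.finiteEnergy_cutoff_mul (hn : 1 ≤ n) (hs : s ∈ Ioo (0 : ℝ) 1) (hlam : 0 < lam)
    (hd1 : d ≤ 1) (hm : Measurable (Function.uncurry K)) (hK0 : ∀ x y, 0 ≤ K x y)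
    (hK : KBounds s β lam Lam M K) {Ω E : Set (V n)} (hΩ : IsOpen Ω) (hEΩ : E ⊆ Ω)
    (hE : thickening d E ⊆ Ω) {u η : V n → ℝ} {L : ℝ} (hu : MemX Ω K u) (hη : IsCutoff L η)
    (hη0 : ∀ x, x ∉ E → η x = 0) :
    FiniteEnergy d ((n : ℝ) + 2 * s) (fun x => η x * u x) ∧
      sqNorm (fun x => η x * u x) ≤ ∫ x in Ω, u x ^ 2 := by
  obtain ⟨hum, hu2, huE⟩ := hu
  set a : ℝ := (n : ℝ) + 2 * s
  have hU : Integrable (Ω.indicator fun x => u x ^ 2) :=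
    (integrable_indicator_iff hΩ.measurableSet).2 hu2
  have hle : ∀ x, (η x * u x) ^ 2 ≤ Ω.indicator (fun x => u x ^ 2) x := fun x => by
    by_cases hx : x ∈ E
    · rw [indicator_of_mem (hEΩ hx)]; exact hη.sq_mul_le u x
    · rw [hη0 x hx, zero_mul, zero_pow two_ne_zero]
      exact indicator_nonneg (fun _ _ => sq_nonneg _) x
  have hmw : Measurable fun x => η x * u x := hη.measurable.mul hum
  have hsq : Integrable fun x => (η x * u x) ^ 2 :=
    hU.mono' (hmw.pow_const 2).aestronglyMeasurable
      (.of_forall fun x => by rw [Real.norm_of_nonneg (sq_nonneg _)]; exact hle x)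
  refine ⟨⟨hmw, hsq, ?_⟩, ?_⟩
  · have hG := (((integrable_indicator_iff (measurableSet_crossSet hΩ.measurableSet)).2
      huE).const_mul (2 / lam)).add
      ((integrable_snd_mul_sub hU (integrable_sq_mul_riesz hn d hs.2)).1.const_mul (2 * L ^ 2))
    refine hG.mono' ((measurable_incr hmw).pow_const 2 |>.mul
      (measurable_riesz_sub d a)).aestronglyMeasurable ?_
    filter_upwards [(isNearKernel_nearKer hm hK hs.1 hlam hd1).bounds] with p hp
    have hr := riesz_nonneg d a (p.1 - p.2)
    rw [Real.norm_of_nonneg (mul_nonneg (sq_nonneg _) hr)]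
    have h1 : 0 ≤ 2 / lam * (crossSet Ω).indicator
        (fun p : V n × V n => (u p.1 - u p.2) ^ 2 * K p.1 p.2) p :=
      mul_nonneg (by positivity)
        (indicator_nonneg (fun q _ => mul_nonneg (sq_nonneg _) (hK0 _ _)) p)
    have h2 : 0 ≤ 2 * L ^ 2 * (Ω.indicator (fun x => u x ^ 2) p.2 *
        (‖p.1 - p.2‖ ^ 2 * riesz d a (p.1 - p.2))) :=
      mul_nonneg (by positivity) (mul_nonneg
        (indicator_nonneg (fun _ _ => sq_nonneg _) _) (by positivity))
    change _ ≤ 2 / lam * _ + 2 * L ^ 2 * _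
    by_cases hnear : ‖p.1 - p.2‖ < d
    · by_cases hEE : p.1 ∈ E ∨ p.2 ∈ E
      · have hΩΩ : p.1 ∈ Ω ∧ p.2 ∈ Ω := by
          rcases hEE with h | h
          · exact mem_of_near hE h hnear
          · exact (mem_of_near hE h (by rwa [norm_sub_rev])).symm
        rw [indicator_of_mem (show p ∈ crossSet Ω from Or.inl hΩΩ.1), indicator_of_mem hΩΩ.2]
        have hp1 := hp.1
        rw [nearKer, if_pos hnear] at hp1
        have h3 := mul_le_mul_of_nonneg_right (hη.incr_mul_sq_le u p) hr
        have h4 : incr u p ^ 2 * riesz d a (p.1 - p.2) ≤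
            lam⁻¹ * ((u p.1 - u p.2) ^ 2 * K p.1 p.2) := by
          rw [inv_mul_eq_div, le_div_iff₀ hlam, mul_assoc, mul_comm _ lam]
          exact mul_le_mul_of_nonneg_left hp1 (sq_nonneg _)
        calc _ ≤ _ := h3
          _ = 2 * (incr u p ^ 2 * riesz d a (p.1 - p.2)) +
              2 * L ^ 2 * (u p.2 ^ 2 * (‖p.1 - p.2‖ ^ 2 * riesz d a (p.1 - p.2))) := by ring
          _ ≤ 2 * (lam⁻¹ * ((u p.1 - u p.2) ^ 2 * K p.1 p.2)) + _ := by gcongr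
          _ = _ := by rw [← mul_assoc, ← div_eq_mul_inv]
      · push Not at hEE
        have : incr (fun x => η x * u x) p = 0 := by
          simp [incr, hη0 _ hEE.1, hη0 _ hEE.2]
        rw [this]
        simpa using add_nonneg h1 h2
    · rw [show riesz d a (p.1 - p.2) = 0 from if_neg hnear] at h2 ⊢
      simpa using add_nonneg h1 h2
  · rw [← integral_indicator hΩ.measurableSet]
    exact integral_mono hsq hU hle

theorem FiniteEnergy.memX0 (hs : s ∈ Ioo (0 : ℝ) 1) (hβ : 0 < β) (hlam : 0 < lam)
    (hLam : 0 ≤ Lam) (hM : 0 ≤ M) (hd : 0 < d) (hd1 : d ≤ 1)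
    (hm : Measurable (Function.uncurry K)) (hK0 : ∀ x y, 0 ≤ K x y)
    (hK : KBounds s β lam Lam M K) {Ω : Set (V n)} {φ : V n → ℝ}
    (hφ : FiniteEnergy d ((n : ℝ) + 2 * s) φ) (hφ0 : ∀ x, x ∉ Ω → φ x = 0) :
    MemX0 Ω K φ := by
  refine ⟨⟨hφ.measurable, hφ.sq.integrableOn, Integrable.integrableOn ?_⟩, .of_forall hφ0⟩
  set c := 2 * Lam * d ^ (-((n : ℝ) + 2 * s)) + 2 * M
  have hc : 0 ≤ c := by positivity
  have hw : Integrable (weight ((n : ℝ) + β) : V n → ℝ) := integrable_weight hβ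
  have hG := (hφ.energy.const_mul Lam).add
    (((integrable_fst_mul_sub hφ.sq hw (weight_neg _)).1.add
      (integrable_snd_mul_sub hφ.sq hw).1).const_mul (2 * c))
  refine hG.mono' (((measurable_incr hφ.measurable).pow_const 2).mul hm).aestronglyMeasurable ?_
  filter_upwards [(isNearKernel_nearKer hm hK hs.1 hlam hd1).bounds,
    hK.farKer_le hs.1 hβ hLam hM hK0 hd] with p h1 h2
  have hwp := (weight_pos ((n : ℝ) + β) (p.1 - p.2)).le
  rw [Real.norm_of_nonneg (mul_nonneg (sq_nonneg _) (hK0 _ _)), ← nearKer_add_farKer d K p]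
  calc (φ p.1 - φ p.2) ^ 2 * (nearKer d K p + farKer d K p)
      ≤ (φ p.1 - φ p.2) ^ 2 * (Lam * riesz d ((n : ℝ) + 2 * s) (p.1 - p.2) +
          c * weight ((n : ℝ) + β) (p.1 - p.2)) :=
        mul_le_mul_of_nonneg_left (add_le_add h1.2 ((le_abs_self _).trans h2)) (sq_nonneg _)
    _ = Lam * (incr φ p ^ 2 * riesz d ((n : ℝ) + 2 * s) (p.1 - p.2)) +
          c * ((φ p.1 - φ p.2) ^ 2 * weight ((n : ℝ) + β) (p.1 - p.2)) := by
        unfold incr; ring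
    _ ≤ Lam * (incr φ p ^ 2 * riesz d ((n : ℝ) + 2 * s) (p.1 - p.2)) +
          c * ((2 * (φ p.1 ^ 2 + φ p.2 ^ 2)) * weight ((n : ℝ) + β) (p.1 - p.2)) := by
        gcongr; nlinarith [sq_nonneg (φ p.1 + φ p.2)]
    _ = _ := by simp only [Pi.add_apply]; ring

theorem abs_energyForm_sub_kerForm_le {c a : ℝ} {u φ : V n → ℝ}
    (hm : Measurable (Function.uncurry K)) (hu : Measurable u) (hφ : Measurable φ)
    (hfar : ∀ᵐ p : V n × V n, |farKer d K p| ≤ c * weight a (p.1 - p.2))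
    (hw : Integrable fun p : V n × V n => |incr u p * incr φ p| * weight a (p.1 - p.2))
    (hnear : Integrable fun p => incr u p * incr φ p * nearKer d K p) :
    |energyForm K u φ - kerForm (nearKer d K) u φ| ≤
      c * ∫ p : V n × V n, |incr u p * incr φ p| * weight a (p.1 - p.2) := by
  have hle : ∀ᵐ p : V n × V n, ‖incr u p * incr φ p * farKer d K p‖ ≤
      c * (|incr u p * incr φ p| * weight a (p.1 - p.2)) := by
    filter_upwards [hfar] with p hp
    rw [norm_mul, Real.norm_eq_abs, Real.norm_eq_abs]
    calc _ ≤ |incr u p * incr φ p| * (c * weight a (p.1 - p.2)) := by gcongr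
      _ = _ := by ring
  have hF : Integrable fun p => incr u p * incr φ p * farKer d K p :=
    (hw.const_mul c).mono' (((measurable_incr hu).mul (measurable_incr hφ)).mul
      (measurable_farKer d hm)).aestronglyMeasurable hle
  have hsum : (fun p : V n × V n => (u p.1 - u p.2) * (φ p.1 - φ p.2) * K p.1 p.2) =
      fun p => incr u p * incr φ p * nearKer d K p + incr u p * incr φ p * farKer d K p := by
    funext p
    rw [← nearKer_add_farKer d K p, incr, incr]; ring
  have hE : energyForm K u φ =
      ∫ p : V n × V n, (u p.1 - u p.2) * (φ p.1 - φ p.2) * K p.1 p.2 := by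
    have hint : Integrable fun p : V n × V n => (u p.1 - u p.2) * (φ p.1 - φ p.2) * K p.1 p.2 := by
      rw [hsum]; exact hnear.add hF
    exact (integral_prod _ hint).symm
  rw [hE, hsum, integral_add hnear hF, kerForm, add_sub_cancel_left, ← integral_const_mul]
  exact norm_integral_le_of_norm_le (hw.const_mul c) hle

end Localization

/-- Inside `Ω`, a solution is a solution for the truncated kernel up to a bounded right-hand
side. -/
theorem exists_localization (hn : 1 ≤ n) {s β lam Lam M d R : ℝ} (hs : s ∈ Ioo (0 : ℝ) 1)
    (hβ : 0 < β) (hlam : 0 < lam) (hLam : 0 ≤ Lam) (hM : 0 ≤ M) (hd : 0 < d) (hd1 : d ≤ 1)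
    {Ω E : Set (V n)} (hΩ : IsOpen Ω) (hE : thickening (7 * d) E ⊆ Ω)
    (hR : ∀ x ∈ thickening (4 * d) E, ‖x‖ ≤ R) :
    ∃ C ≥ 1, ∀ (K : V n → V n → ℝ) (u f : V n → ℝ), Measurable (Function.uncurry K) →
      (∀ x y, 0 ≤ K x y) → KBounds s β lam Lam M K → MemX Ω K u → HasFiniteWnorm β 0 u →
      Measurable f → IntegrableOn (fun x => f x ^ 2) Ω → IsSolution Ω K u f →
      ∃ v : V n → ℝ, FiniteEnergy d ((n : ℝ) + 2 * s) v ∧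
        sqNorm v ≤ (C * (L2norm Ω u + wnorm β 0 u + L2norm Ω f)) ^ 2 ∧
        (∀ x ∈ E, v x = u x) ∧
        ∀ φ, FiniteEnergy d ((n : ℝ) + 2 * s) φ → (∀ x, x ∉ thickening (4 * d) E → φ x = 0) →
          kerForm (nearKer d K) v φ ≤
            C * (L2norm Ω u + wnorm β 0 u + L2norm Ω f) * √(sqNorm φ) := by
  obtain ⟨η, hη, hη1, hη0⟩ := exists_isCutoff hd (thickening (5 * d) E)
  obtain ⟨Cf, hCf, hfar⟩ := far_form_estimate hβ Ω R
  set c := 2 * Lam * d ^ (-((n : ℝ) + 2 * s)) + 2 * M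
  have hc : 0 ≤ c := by positivity
  have hE0 : E ⊆ thickening (5 * d) E := self_subset_thickening (by positivity) E
  have hE4 : thickening (4 * d) E ⊆ Ω := (thickening_mono (by linarith) E).trans hE
  have hE6 : thickening d (thickening (5 * d) E) ⊆ Ω :=
    ((thickening_thickening_subset _ _ _).trans (thickening_mono (by linarith) E)).trans hE
  have hE7 : thickening d (thickening d (thickening (5 * d) E)) ⊆ Ω := by
    refine (thickening_thickening_subset _ _ _).trans
      ((thickening_thickening_subset _ _ _).trans ((thickening_mono (by linarith) E).trans hE))
  have h45 : thickening d (thickening (4 * d) E) ⊆ thickening (5 * d) E :=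
    (thickening_thickening_subset _ _ _).trans (thickening_mono (by linarith) E)
  refine ⟨1 + c * Cf, by nlinarith [mul_nonneg hc hCf],
    fun K u f hm hK0 hK hu huw hfm hf2 hsol => ?_⟩
  have hU0 : 0 ≤ L2norm Ω u := by rw [L2norm_eq_sqrt]; positivity
  have hF0 : 0 ≤ L2norm Ω f := by rw [L2norm_eq_sqrt]; positivity
  have hW0 : 0 ≤ wnorm β 0 u := integral_nonneg fun x => by positivity
  obtain ⟨hv, hvsq⟩ := hu.finiteEnergy_cutoff_mul hn hs hlam hd1 hm hK0 hK hΩ hE6 hE7 hη hη0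
  have hnk := isNearKernel_nearKer hm hK hs.1 hlam hd1
  have huv : ∀ x ∈ thickening d (thickening (4 * d) E), u x = η x * u x := fun x hx => by
    rw [hη1 x (h45 hx), one_mul]
  refine ⟨fun x => η x * u x, hv, hvsq.trans ?_, fun x hx => by simp [hη1 x (hE0 hx)],
    fun φ hφ hφ0 => ?_⟩
  · have : ∫ x in Ω, u x ^ 2 = L2norm Ω u ^ 2 := by
      rw [L2norm_eq_sqrt, Real.sq_sqrt (integral_nonneg fun x => sq_nonneg _)]
    rw [this]
    refine pow_le_pow_left₀ hU0 ?_ 2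
    nlinarith [mul_nonneg (mul_nonneg hc hCf) (add_nonneg (add_nonneg hU0 hW0) hF0)]
  · have hφΩ : ∀ x, x ∉ Ω → φ x = 0 := fun x hx => hφ0 x fun h => hx (hE4 h)
    obtain ⟨hfi, hfb⟩ := hfar u φ hu.1 hu.2.1 huw hφ.measurable hφ.sq hφΩ
      fun x hx => hφ0 x fun h => absurd (hR x h) (not_le.2 hx)
    have hnear : Integrable fun p => incr u p * incr φ p * nearKer d K p :=
      (integrable_kerForm hLam hnk.aesm (hnk.abs_le hlam.le) hv hφ).1.congr
        (.of_forall fun p => (mul_incr_congr_of_near hnk.support hφ0 huv p).symm)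
    have hdiff := abs_energyForm_sub_kerForm_le hm hu.1 hφ.measurable
      (hK.farKer_le hs.1 hβ hLam hM hK0 hd) hfi hnear
    rw [kerForm_congr_of_near hnk.support hφ0 huv,
      hsol φ (hφ.memX0 hs hβ hlam hLam hM hd hd1 hm hK0 hK hφΩ)] at hdiff
    have hrhs : ∫ x in Ω, f x * φ x ≤ L2norm Ω f * √(sqNorm φ) := by
      rw [setIntegral_eq_integral_of_forall_compl_eq_zero
        (fun x hx => by rw [hφΩ x hx, mul_zero])]
      refine (le_abs_self _).trans (abs_integral_le_integral_abs.trans ?_)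
      exact (integrable_mul_of_zero_outside hfm hf2 hφ.measurable hφ.sq hφΩ).2
    have h1 := (abs_le.1 hdiff).1
    have h2 := mul_le_mul_of_nonneg_left hfb hc
    have hφn : 0 ≤ √(sqNorm φ) := Real.sqrt_nonneg _
    have h3 : 0 ≤ (L2norm Ω u + wnorm β 0 u) * √(sqNorm φ) := by positivity
    have h4 : 0 ≤ c * Cf * (L2norm Ω f * √(sqNorm φ)) := by positivity
    calc kerForm (nearKer d K) (fun x => η x * u x) φ
        ≤ L2norm Ω f * √(sqNorm φ) +
            c * (Cf * (L2norm Ω u + wnorm β 0 u) * √(sqNorm φ)) := by linarith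
      _ ≤ _ := by linarith

theorem measurableSet_shift2 {U : Set (V n)} (hU : MeasurableSet U) (z : V n) :
    MeasurableSet (shift2 U z) :=
  hU.inter ((hU.preimage (measurable_add_const z)).inter
    (hU.preimage (measurable_add_const (2 • z))))

theorem L2norm_le_sqrt_sqNorm {A : Set (V n)} (hA : MeasurableSet A) {v w : V n → ℝ}
    (hw : Integrable fun x => w x ^ 2) (h : ∀ x ∈ A, w x = v x) :
    L2norm A v ≤ √(sqNorm w) := by
  rw [L2norm_eq_sqrt]
  refine Real.sqrt_le_sqrt ?_
  rw [← setIntegral_congr_fun hA fun x hx => congrArg (· ^ 2) (h x hx)]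
  exact setIntegral_le_integral hw (.of_forall fun x => sq_nonneg _)

theorem L2norm_diff2_le {A : Set (V n)} (hA : MeasurableSet A) {u : V n → ℝ}
    (hum : Measurable u) (hu : IntegrableOn (fun x => u x ^ 2) A) (z : V n) :
    L2norm (shift2 A z) (diff2 z u) ≤ √18 * L2norm A u := by
  set w : V n → ℝ := A.indicator u
  have hwm : Measurable w := hum.indicator hA
  have hw2 : (fun x => w x ^ 2) = A.indicator fun x => u x ^ 2 := by
    funext x
    by_cases hx : x ∈ A <;> simp [w, hx]
  have hw : Integrable fun x => w x ^ 2 := by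
    rw [hw2]; exact (integrable_indicator_iff hA).2 hu
  have hwn : sqNorm w = ∫ x in A, u x ^ 2 := by
    rw [sqNorm, hw2, integral_indicator hA]
  have hG : Integrable fun x => 3 * w (x + 2 • z) ^ 2 + 12 * w (x + z) ^ 2 + 3 * w x ^ 2 :=
    (((hw.comp_add_right (2 • z)).const_mul 3).add
      ((hw.comp_add_right z).const_mul 12)).add (hw.const_mul 3)
  have hle : ∀ x, diff2 z w x ^ 2 ≤
      3 * w (x + 2 • z) ^ 2 + 12 * w (x + z) ^ 2 + 3 * w x ^ 2 := fun x => by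
    unfold diff2
    nlinarith [sq_nonneg (w (x + 2 • z) + 2 * w (x + z)), sq_nonneg (w (x + 2 • z) - w x),
      sq_nonneg (2 * w (x + z) + w x)]
  have hdm : Measurable (diff2 z w) := by
    unfold diff2; fun_prop
  have hd : Integrable fun x => diff2 z w x ^ 2 :=
    hG.mono' (hdm.pow_const 2).aestronglyMeasurable
      (.of_forall fun x => by rw [Real.norm_of_nonneg (sq_nonneg _)]; exact hle x)
  refine (L2norm_le_sqrt_sqNorm (measurableSet_shift2 hA z) hd fun x hx => ?_).trans ?_
  · simp [diff2, w, hx.1, hx.2.1, hx.2.2]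
  · rw [L2norm_eq_sqrt, ← Real.sqrt_mul (by norm_num)]
    refine Real.sqrt_le_sqrt ((integral_mono hd hG hle).trans (le_of_eq ?_))
    have e1 : ∫ x, w (x + 2 • z) ^ 2 = sqNorm w := sqNorm_shift w _
    have e2 : ∫ x, w (x + z) ^ 2 = sqNorm w := sqNorm_shift w _
    rw [integral_add, integral_add, integral_const_mul, integral_const_mul, integral_const_mul,
      e1, e2, ← hwn, sqNorm]
    · ring
    · exact (hw.comp_add_right (2 • z)).const_mul 3
    · exact (hw.comp_add_right z).const_mul 12
    · exact ((hw.comp_add_right (2 • z)).const_mul 3).add ((hw.comp_add_right z).const_mul 12)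
    · exact hw.const_mul 3

theorem exists_thickening_subset {Ω Ω' : Set (V n)} (hΩ : IsOpen Ω)
    (hc : IsCompact (closure Ω')) (h : closure Ω' ⊆ Ω) :
    ∃ d R : ℝ, 0 < d ∧ d < 1 ∧ thickening (7 * d) Ω' ⊆ Ω ∧
      ∀ x ∈ thickening (4 * d) Ω', ‖x‖ ≤ R := by
  obtain ⟨δ, hδ, hsub⟩ := hc.exists_thickening_subset_open hΩ h
  obtain ⟨R, hR⟩ := ((hc.isBounded.subset subset_closure).thickening
    (δ := 4)).exists_norm_le
  have h1 : min (1 / 2) (δ / 7) ≤ 1 / 2 := min_le_left _ _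
  have h2 : min (1 / 2) (δ / 7) ≤ δ / 7 := min_le_right _ _
  refine ⟨min (1 / 2) (δ / 7), R, by positivity, by linarith, ?_,
    fun x hx => hR x (thickening_mono (by linarith) Ω' hx)⟩
  exact ((thickening_mono (by linarith) Ω').trans
    (thickening_subset_of_subset δ subset_closure)).trans hsub

/-- **Theorem (Nikol'skii regularity).** A weak solution of `E_K(u,·)=f` in `Ω`
belongs to `N^{2s,2}(Ω')` for every `Ω' ⊂⊂ Ω`, with the corresponding estimate. -/
theorem nikolskii_interior_regularity {n : ℕ} (hn : 1 ≤ n)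
    (s β lam Lam M Gam : ℝ) (hs : s ∈ Ioo (0 : ℝ) 1) (hβ : 0 < β)
    (hlam : 0 < lam) (hlL : lam ≤ Lam) (hM : 0 < M) (hGam : 0 < Gam)
    (Ω : Set (V n)) (hΩ : IsOpen Ω)
    (Ω' : Set (V n)) (hΩ' : IsOpen Ω') (hΩ'c : IsCompact (closure Ω'))
    (hΩ'Ω : closure Ω' ⊆ Ω) :
    ∃ C > 0, ∀ (K : V n → V n → ℝ) (u f : V n → ℝ),
      Measurable (Function.uncurry K) → (∀ x y, 0 ≤ K x y) →
      KSym K → KBounds s β lam Lam M K → KHolder s Gam K →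
      MemX Ω K u → HasFiniteWnorm β 0 u →
      Measurable f → IntegrableOn (fun x => f x ^ 2) Ω →
      IsSolution Ω K u f →
      ∀ z : V n, z ≠ 0 →
        L2norm Ω' u + ‖z‖ ^ (-(2 * s)) * L2norm (shift2 Ω' z) (diff2 z u) ≤
          C * (L2norm Ω u + wnorm β 0 u + L2norm Ω f) := by
  obtain ⟨d, R, hd, hd1', hE, hR⟩ := exists_thickening_subset hΩ hΩ'c hΩ'Ω
  have hd1 : d ≤ 1 := hd1'.le
  have hLam : 0 ≤ Lam := hlam.le.trans hlL
  obtain ⟨C₁, hC₁, hest⟩ := second_difference_estimate hn hs hd hlam hLam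
    (show (0 : ℝ) ≤ 3 * Gam by positivity)
  obtain ⟨C₂, hC₂, hloc⟩ := exists_localization hn hs hβ hlam hLam hM.le hd hd1 hΩ hE hR
  have hC₂0 : 0 < C₂ := one_pos.trans_le hC₂
  refine ⟨1 + √C₁ * C₂ + (d / 2) ^ (-(2 * s)) * √18, by positivity,
    fun K u f hm hK0 _ hK hH hu huw hfm hf2 hsol z hz => ?_⟩
  have hΩΩ : Ω' ⊆ Ω := subset_closure.trans hΩ'Ω
  have hU0 : 0 ≤ L2norm Ω u := by rw [L2norm_eq_sqrt]; positivity
  have hF0 : 0 ≤ L2norm Ω f := by rw [L2norm_eq_sqrt]; positivity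
  have hW0 : 0 ≤ wnorm β 0 u := integral_nonneg fun x => by positivity
  set T : ℝ := L2norm Ω u + wnorm β 0 u + L2norm Ω f
  have hT : 0 ≤ T := by positivity
  have hUT : L2norm Ω u ≤ T := by simp only [T]; linarith
  have hsub : L2norm Ω' u ≤ L2norm Ω u := by
    rw [L2norm_eq_sqrt, L2norm_eq_sqrt]
    exact Real.sqrt_le_sqrt (setIntegral_mono_set hu.2.1
      (.of_forall fun x => sq_nonneg _) hΩΩ.eventuallyLE)
  have hzp : 0 < ‖z‖ := norm_pos_iff.2 hz
  have key : ‖z‖ ^ (-(2 * s)) * L2norm (shift2 Ω' z) (diff2 z u) ≤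
      (√C₁ * C₂ + (d / 2) ^ (-(2 * s)) * √18) * T := by
    rcases le_or_gt (2 * ‖z‖) d with hzd | hzd
    · obtain ⟨v, hv, hvsq, hvu, hvφ⟩ := hloc K u f hm hK0 hK hu huw hfm hf2 hsol
      have hhol : ∀ᵐ p : V n × V n, |nearKer d K (p.1 + -z, p.2 + -z) - nearKer d K p| ≤
          3 * Gam * ‖z‖ ^ s * riesz d ((n : ℝ) + 2 * s) (p.1 - p.2) := by
        rw [← norm_neg z] at hzd ⊢
        exact hH.nearKer_shift_le hK hs hlam hGam.le hd1 (neg_ne_zero.2 hz) (hzd.trans_lt hd1')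
      obtain ⟨w, -, hw2, hwsq, hwd⟩ := hest (nearKer d K) Ω' v (C₂ * T)
        (isNearKernel_nearKer hm hK hs.1 hlam hd1) (by positivity) hv hvsq hvφ z hz hzd hhol
      have hwu : ∀ x ∈ shift2 Ω' z, w x = diff2 z u x := fun x hx => by
        rw [hwd x hx, diff2, diff2, hvu _ hx.1, hvu _ hx.2.1, hvu _ hx.2.2]
      have h1 : L2norm (shift2 Ω' z) (diff2 z u) ≤ √C₁ * (‖z‖ ^ (2 * s) * (C₂ * T)) := by
        refine (L2norm_le_sqrt_sqNorm (measurableSet_shift2 hΩ'.measurableSet z) hw2 hwu).trans ?_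
        rw [← Real.sqrt_sq (show 0 ≤ ‖z‖ ^ (2 * s) * (C₂ * T) by positivity),
          ← Real.sqrt_mul hC₁.le]
        exact Real.sqrt_le_sqrt (hwsq.trans_eq (by ring))
      calc _ ≤ ‖z‖ ^ (-(2 * s)) * (√C₁ * (‖z‖ ^ (2 * s) * (C₂ * T))) := by gcongr
        _ = ‖z‖ ^ (-(2 * s)) * ‖z‖ ^ (2 * s) * (√C₁ * C₂ * T) := by ring
        _ = √C₁ * C₂ * T := by
          rw [← Real.rpow_add hzp, neg_add_cancel, Real.rpow_zero, one_mul]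
        _ ≤ _ := by gcongr; exact le_add_of_nonneg_right (by positivity)
    · have h1 := L2norm_diff2_le hΩ'.measurableSet hu.1 (hu.2.1.mono_set hΩΩ) z
      have h2 : ‖z‖ ^ (-(2 * s)) ≤ (d / 2) ^ (-(2 * s)) :=
        Real.rpow_le_rpow_of_nonpos (by positivity) (by linarith) (by linarith [hs.1])
      calc _ ≤ (d / 2) ^ (-(2 * s)) * (√18 * T) := by
            refine mul_le_mul h2 (h1.trans ?_) ?_ (by positivity)
            · gcongr
              exact hsub.trans hUT
            · rw [L2norm_eq_sqrt]
              positivity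
        _ = (d / 2) ^ (-(2 * s)) * √18 * T := by ring
        _ ≤ _ := by gcongr; exact le_add_of_nonneg_left (by positivity)
  calc _ ≤ T + (√C₁ * C₂ + (d / 2) ^ (-(2 * s)) * √18) * T := add_le_add (hsub.trans hUT) key
    _ = _ := by ring
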